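/- arXiv:2507.10907 — 3 statements merged into one kernel-verified Lean document; each statement's English description precedes it below -/
import Mathlib

section
/- Every topological gyrogroup G generated by an open subset with compact closure has a suitable set. -/
universe u

class Gyrogroup (G : Type u) where
  add : G → G → G
  zero : G
  neg : G → G
  gyr : G → G → G → G
  zero_add : ∀ x, add zero x = x
  add_zero : ∀ x, add x zero = x
  neg_add : ∀ x, add (neg x) x = zero
  add_neg : ∀ x, add x (neg x) = zero
  gyr_bij : ∀ x y, Function.Bijective (gyr x y)
  gyr_add : ∀ x y a b, gyr x y (add a b) = add (gyr x y a) (gyr x y b)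
  left_assoc : ∀ x y z, add x (add y z) = add (add x y) (gyr x y z)
  loop : ∀ x y, gyr (add x y) y = gyr x y

namespace Gyrogroup

variable {G : Type u}

instance [Gyrogroup G] : Add G := ⟨Gyrogroup.add⟩
instance [Gyrogroup G] : Zero G := ⟨Gyrogroup.zero⟩
instance [Gyrogroup G] : Neg G := ⟨Gyrogroup.neg⟩

/-- The gyrogroup cooperation `x ⊞ y = x ⊕ gyr[x, ⊖y](y)`. -/
def coadd [Gyrogroup G] (x y : G) : G := x + gyr x (-y) y

/-- `S` is a subgyrogroup: contains the identity and is closed under `⊕`, `⊖` and the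
gyroautomorphisms. -/
def IsSubgyro [Gyrogroup G] (S : Set G) : Prop :=
  (0 : G) ∈ S ∧ (∀ ⦃a b : G⦄, a ∈ S → b ∈ S → a + b ∈ S) ∧
    (∀ ⦃a : G⦄, a ∈ S → -a ∈ S) ∧
    ∀ ⦃a b c : G⦄, a ∈ S → b ∈ S → c ∈ S → gyr a b c ∈ S

/-- The subgyrogroup generated by `A`. -/
def gen [Gyrogroup G] (A : Set G) : Set G := ⋂₀ {S : Set G | IsSubgyro S ∧ A ⊆ S}

/-- `N` is a normal subgyrogroup: the kernel of a gyrogroup homomorphism. -/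
def IsNormalSubgyro [Gyrogroup G] (N : Set G) : Prop :=
  ∃ (H : Type u) (i : Gyrogroup H) (f : G → H),
    (∀ a b : G, f (a + b) = i.add (f a) (f b)) ∧ N = f ⁻¹' {i.zero}

/-- A (Hausdorff) topological gyrogroup. -/
class TopGyrogroup (G : Type u) [Gyrogroup G] [TopologicalSpace G] : Prop where
  t2 : T2Space G
  continuous_add : Continuous fun p : G × G => p.1 + p.2
  continuous_neg : Continuous fun x : G => -x

/-- `μ` is a neighborhood base at `0` consisting of gyr-invariant sets. -/
def IsGyroNhdBase [Gyrogroup G] [TopologicalSpace G] (μ : Set (Set G)) : Prop :=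
  (∀ U ∈ μ, U ∈ nhds (0 : G)) ∧ (∀ W ∈ nhds (0 : G), ∃ U ∈ μ, U ⊆ W) ∧
    ∀ U ∈ μ, ∀ x y : G, gyr x y '' U = U

/-- A strongly topological gyrogroup: some neighborhood base at `0` is gyr-invariant. -/
def StronglyTop (G : Type u) [Gyrogroup G] [TopologicalSpace G] : Prop :=
  ∃ μ : Set (Set G), IsGyroNhdBase μ

/-- `S` is a suitable set for `G`. -/
def IsSuitable [Gyrogroup G] [TopologicalSpace G] (S : Set G) : Prop :=
  DiscreteTopology S ∧ IsClosed (S ∪ {(0 : G)}) ∧ Dense (gen S)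

end Gyrogroup

open Gyrogroup

namespace GyroAux

open Filter Topology Set

section algebra

variable {G : Type u} [Gyrogroup G]

theorem zadd (x : G) : 0 + x = x := Gyrogroup.zero_add x
theorem addz (x : G) : x + 0 = x := Gyrogroup.add_zero x
theorem negadd (x : G) : -x + x = 0 := Gyrogroup.neg_add x
theorem addneg (x : G) : x + -x = 0 := Gyrogroup.add_neg x
theorem gyradd (x y a b : G) : gyr x y (a + b) = gyr x y a + gyr x y b :=
  Gyrogroup.gyr_add x y a b
theorem lassoc (x y z : G) : x + (y + z) = (x + y) + gyr x y z := Gyrogroup.left_assoc x y z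
theorem gloop (x y : G) : gyr (x + y) y = gyr x y := Gyrogroup.loop x y

theorem lcancel {a b c : G} (h : a + b = a + c) : b = c := by
  have h2 : -a + (a + b) = -a + (a + c) := by rw [h]
  rw [lassoc, lassoc, negadd, zadd, zadd] at h2
  exact (Gyrogroup.gyr_bij _ _).1 h2

theorem gyr_zero_left (a z : G) : gyr 0 a z = z := by
  have h := lassoc 0 a z
  rw [zadd, zadd] at h
  exact (lcancel h).symm

theorem gyr_neg_self (a z : G) : gyr (-a) a z = z := by
  rw [← gloop, negadd, gyr_zero_left]

theorem nadd (a b : G) : -a + (a + b) = b := by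
  rw [lassoc, negadd, zadd, gyr_neg_self]

theorem negneg (a : G) : -(-a) = a := by
  apply lcancel (a := -a)
  rw [addneg, negadd]

theorem addn (a b : G) : a + (-a + b) = b := by
  have := nadd (-a) b
  rwa [negneg] at this

theorem neg_zero' : -(0 : G) = 0 := by
  have := negadd (0 : G)
  rwa [addz] at this

theorem gyr_eq (a b c : G) : gyr a b c = -(a + b) + (a + (b + c)) := by
  rw [lassoc a b c, nadd]

theorem gyr_zero (a b : G) : gyr a b 0 = 0 := by
  rw [gyr_eq, addz, negadd]

theorem gyr_neg (a b c : G) : gyr a b (-c) = - gyr a b c := by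
  apply lcancel (a := gyr a b c)
  rw [← gyradd, addneg, addneg, gyr_zero]

theorem left_tr (a b c : G) : -(a + b) + (a + c) = gyr a b (-b + c) := by
  conv_lhs => rw [← addn b c, lassoc a b, nadd]

theorem neg_symm (x z : G) : -z + x = gyr x (-x + z) (-(-x + z)) := by
  have := left_tr x (-x + z) 0
  rwa [addn, addz, addz] at this

/-- gyr-invariance. -/
def GInv (V : Set G) : Prop := ∀ x y v : G, gyr x y v ∈ V ↔ v ∈ V

/-- the left-invariant relation associated to `V`. -/
def R (V : Set G) (x z : G) : Prop := -x + z ∈ V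

structure Sy (V : Set G) : Prop where
  zero : (0 : G) ∈ V
  inv : GInv V
  neg : ∀ v ∈ V, -v ∈ V

structure ISub (N : Set G) : Prop where
  sy : Sy N
  add : ∀ a ∈ N, ∀ b ∈ N, a + b ∈ N

theorem R_refl {V : Set G} (h : Sy V) (x : G) : R V x x := by
  unfold R; rw [negadd]; exact h.zero

theorem R_symm {V : Set G} (h : Sy V) {x z : G} (hx : R V x z) : R V z x := by
  unfold R at *
  rw [neg_symm, h.inv]
  exact h.neg _ hx

theorem R_trans {V W : Set G} (h : Sy V) (hVW : ∀ a ∈ V, ∀ b ∈ V, a + b ∈ W) {x y z : G}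
    (hx : R V x y) (hy : R V y z) : R W x z := by
  unfold R at *
  have e : -x + z = (-x + y) + gyr (-x) y (-y + z) := by
    rw [← lassoc, addn]
  rw [e]
  exact hVW _ hx _ ((h.inv _ _ _).2 hy)

theorem R_left {V : Set G} (h : Sy V) (a : G) {x z : G} (hx : R V x z) :
    R V (a + x) (a + z) := by
  unfold R at *
  rw [left_tr, h.inv]; exact hx

theorem R_zero {V : Set G} {x : G} : R V 0 x ↔ x ∈ V := by
  unfold R; rw [neg_zero', zadd]

theorem R_mono {V W : Set G} (h : V ⊆ W) {x z : G} (hx : R V x z) : R W x z := h hx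

theorem ISub.trans {N : Set G} (h : ISub N) {x y z : G} (hx : R N x y) (hy : R N y z) :
    R N x z := R_trans h.sy h.add hx hy

theorem ISub.mem {N : Set G} (h : ISub N) {x y : G} (hx : R N x y) (hm : x ∈ N) : y ∈ N :=
  R_zero.1 (h.trans (R_zero.2 hm) hx)

theorem ISub.mem' {N : Set G} (h : ISub N) {x y : G} (hx : R N x y) (hm : y ∈ N) : x ∈ N :=
  h.mem (R_symm h.sy hx) hm

theorem ISub.R {N : Set G} (h : ISub N) {x y : G} (hx : x ∈ N) (hy : y ∈ N) : R N x y :=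
  h.add _ (h.sy.neg _ hx) _ hy

/-- maximal separated subsets. -/
theorem exists_sep (E V : Set G) (hV : Sy V) :
    ∃ F ⊆ E, (∀ a ∈ F, ∀ b ∈ F, R V a b → a = b) ∧ ∀ x ∈ E, ∃ f ∈ F, R V f x := by
  obtain ⟨F, hF⟩ := zorn_subset {F : Set G | F ⊆ E ∧ ∀ a ∈ F, ∀ b ∈ F, R V a b → a = b} (by
    intro c hc hch
    refine ⟨⋃₀ c, ⟨?_, ?_⟩, fun s hs => subset_sUnion_of_mem hs⟩
    · exact sUnion_subset fun s hs => (hc hs).1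
    · rintro a ⟨s, hs, has⟩ b ⟨t, ht, hbt⟩ hab
      rcases hch.total hs ht with h | h
      · exact (hc ht).2 a (h has) b hbt hab
      · exact (hc hs).2 a has b (h hbt) hab)
  refine ⟨F, hF.prop.1, hF.prop.2, fun x hx => ?_⟩
  by_contra hcon
  push Not at hcon
  have hmem : insert x F ∈ {F : Set G | F ⊆ E ∧ ∀ a ∈ F, ∀ b ∈ F, R V a b → a = b} := by
    refine ⟨insert_subset hx hF.prop.1, ?_⟩
    rintro a (rfl | ha) b (rfl | hb) hab
    · rfl
    · exact absurd (R_symm hV hab) (hcon b hb)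
    · exact absurd hab (hcon a ha)
    · exact hF.prop.2 a ha b hb hab
  have := hF.le_of_ge hmem (subset_insert x F) (mem_insert x F)
  exact hcon x this (R_refl hV x)

end algebra

section topology

variable {G : Type u} [Gyrogroup G] [TopologicalSpace G]

structure IsSeq (V : ℕ → Set G) : Prop where
  sy : ∀ n, Sy (V n)
  nh : ∀ n, V n ∈ 𝓝 (0 : G)
  add : ∀ n, ∀ a ∈ V (n + 1), ∀ b ∈ V (n + 1), a + b ∈ V n

theorem IsSeq.tr {V : ℕ → Set G} (h : IsSeq V) {n : ℕ} {x y z : G}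
    (hx : R (V (n + 1)) x y) (hy : R (V (n + 1)) y z) : R (V n) x z :=
  R_trans (h.sy _) (h.add n) hx hy

theorem IsSeq.anti {V : ℕ → Set G} (h : IsSeq V) : Antitone V :=
  antitone_nat_of_succ_le fun n x hx => by
    have := h.add n x hx 0 (h.sy _).zero
    rwa [addz] at this

theorem IsSeq.isub {V : ℕ → Set G} (h : IsSeq V) : ISub (⋂ n, V n) := by
  refine ⟨⟨?_, ?_, ?_⟩, ?_⟩
  · exact mem_iInter.2 fun n => (h.sy n).zero
  · intro x y v
    simp only [mem_iInter]
    exact forall_congr' fun n => (h.sy n).inv x y v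
  · intro v hv
    simp only [mem_iInter] at *
    exact fun n => (h.sy n).neg v (hv n)
  · intro a ha b hb
    simp only [mem_iInter] at *
    exact fun n => h.add n a (ha _) b (hb _)

theorem ISub.inter {M N : Set G} (hM : ISub M) (hN : ISub N) : ISub (M ∩ N) :=
  ⟨⟨⟨hM.sy.zero, hN.sy.zero⟩, fun x y v => and_congr (hM.sy.inv x y v) (hN.sy.inv x y v),
    fun v hv => ⟨hM.sy.neg v hv.1, hN.sy.neg v hv.2⟩⟩,
    fun a ha b hb => ⟨hM.add a ha.1 b hb.1, hN.add a ha.2 b hb.2⟩⟩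

variable [TopGyrogroup G]

theorem cont_add : Continuous fun p : G × G => p.1 + p.2 := TopGyrogroup.continuous_add
theorem cont_neg : Continuous fun x : G => -x := TopGyrogroup.continuous_neg

theorem cadd {X : Type*} [TopologicalSpace X] {f g : X → G} (hf : Continuous f)
    (hg : Continuous g) : Continuous fun x => f x + g x :=
  cont_add.comp (hf.prodMk hg)

theorem cneg {X : Type*} [TopologicalSpace X] {f : X → G} (hf : Continuous f) :
    Continuous fun x => - f x := cont_neg.comp hf

theorem cleft (a : G) : Continuous fun x : G => a + x := cadd continuous_const continuous_id

theorem cright (a : G) : Continuous fun x : G => -x + a :=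
  cadd (cneg continuous_id) continuous_const

theorem ev_R {V : Set G} (hV : V ∈ 𝓝 (0 : G)) (x : G) : ∀ᶠ z in 𝓝 x, R V x z := by
  have h := (cleft (-x)).tendsto x
  rw [negadd] at h
  exact h hV

theorem IsSeq.closure_sub {V : ℕ → Set G} (h : IsSeq V) (n : ℕ) : closure (V (n + 1)) ⊆ V n := by
  intro x hx
  obtain ⟨z, hz1, hz2⟩ := mem_closure_iff_nhds.1 hx _ (ev_R (h.nh (n + 1)) x)
  exact R_zero.1 (h.tr (R_zero.2 hz2) (R_symm (h.sy _) hz1))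

theorem IsSeq.closed {V : ℕ → Set G} (h : IsSeq V) : IsClosed (⋂ n, V n) := by
  have : (⋂ n, V n) = ⋂ n, closure (V n) := by
    apply subset_antisymm
    · exact iInter_mono fun n => subset_closure
    · refine subset_iInter fun n => (iInter_subset _ (n + 1)).trans (h.closure_sub n)
  rw [this]
  exact isClosed_iInter fun n => isClosed_closure

theorem closed_coset {N : Set G} (hN : IsClosed N) (x : G) : IsClosed {z | R N x z} :=
  hN.preimage (cleft (-x))

theorem coset_sub_image (N : Set G) (x : G) : {z | R N x z} ⊆ (fun z => x + z) '' N :=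
  fun z hz => ⟨-x + z, hz, addn x z⟩

theorem compact_coset {N : Set G} (hN : IsCompact N) (x : G) : IsCompact {z | R N x z} := by
  have : {z | R N x z} = (fun z => x + z) '' N := by
    apply subset_antisymm (coset_sub_image N x)
    rintro _ ⟨z, hz, rfl⟩
    change -x + (x + z) ∈ N
    rwa [nadd]
  rw [this]
  exact hN.image (cleft x)

/-- Generating a subgyrogroup modulo `⋂ V n`. -/
theorem lemX {H : Set G} (hH : ISub H) (hHc : IsClosed H) {V : ℕ → Set G} (hV : IsSeq V)
    {C : Set G} (hC : IsCompact C) (hVC : V 0 ⊆ C) {N : Set G} (hNd : N = H ∩ ⋂ n, V n) :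
    ∃ B ⊆ H, N ⊆ B ∧ (∀ x ∈ B, ∀ z, R N x z → z ∈ B) ∧
      (∀ x, x ∉ N → ∀ᶠ z in 𝓝 x, z ∈ B → R N x z) ∧
      (∀ K, IsSubgyro K → IsClosed K → (∀ x ∈ B, x ∉ N → ∃ k ∈ K, R N x k) →
        ∀ x ∈ H, ∃ k ∈ K, k ∈ H ∧ R N k x) := by
  have hN : ISub N := hNd ▸ hH.inter hV.isub
  have hNc : IsClosed N := hNd ▸ hHc.inter hV.closed
  have hNV : ∀ n, N ⊆ V n := fun n => by
    rw [hNd]; exact inter_subset_right.trans (iInter_subset _ n)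
  have hNH : N ⊆ H := by rw [hNd]; exact inter_subset_left
  let E : ℕ → Set G := fun n => Nat.casesOn n H (fun m => H ∩ V m)
  have hE0 : E 0 = H := rfl
  have hES : ∀ n, E (n + 1) = H ∩ V n := fun n => rfl
  have hEH : ∀ n, E n ⊆ H := by
    rintro (_ | n)
    · exact subset_rfl
    · exact inter_subset_left
  choose F hFE hFs hFc using fun n => exists_sep (E n) (V (n + 1)) (hV.sy _)
  refine ⟨{z | z ∈ N ∨ ∃ n, ∃ f ∈ F n, R N f z}, ?_, ?_, ?_, ?_, ?_⟩
  · rintro z (hz | ⟨n, f, hf, hz⟩)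
    · exact hNH hz
    · exact hH.mem (R_mono hNH hz) (hEH n (hFE n hf))
  · exact fun z hz => Or.inl hz
  · rintro x (hx | ⟨n, f, hf, hx⟩) z hz
    · exact Or.inl (hN.mem hz hx)
    · exact Or.inr ⟨n, f, hf, hN.trans hx hz⟩
  · intro x hx
    by_cases hxH : x ∈ H
    swap
    · filter_upwards [hHc.isOpen_compl.mem_nhds hxH] with z hz hzB
      exfalso
      apply hz
      rcases hzB with (hz | ⟨n, f, hf, hz⟩)
      · exact hNH hz
      · exact hH.mem (R_mono hNH hz) (hEH n (hFE n hf))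
    have : ∃ m, x ∉ V m := by
      by_contra hcon
      push Not at hcon
      exact hx (by rw [hNd]; exact ⟨hxH, mem_iInter.2 hcon⟩)
    obtain ⟨m, hm⟩ := this
    have key : ∀ j, ∀ᶠ z in 𝓝 x, ∀ f ∈ F j, R N f z → R N x z := by
      intro j
      have aux : ∀ z, R (V (j + 3)) x z → ∀ f, R N f z → R (V (j + 2)) x f := by
        intro z hz f hf
        exact hV.tr hz (R_symm (hV.sy _) (R_mono (hNV _) hf))
      by_cases hex : ∃ z, R (V (j + 3)) x z ∧ ∃ f ∈ F j, R N f z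
      · obtain ⟨z, hz, f, hf, hfz⟩ := hex
        have huniq : ∀ z', R (V (j + 3)) x z' → ∀ f' ∈ F j, R N f' z' → f' = f := by
          intro z' hz' f' hf' hfz'
          exact hFs j f' hf' f hf
            (hV.tr (R_symm (hV.sy _) (aux z' hz' f' hfz')) (aux z hz f hfz))
        by_cases hfx : R N f x
        · filter_upwards [ev_R (hV.nh (j + 3)) x] with z' hz' f' hf' hfz'
          rw [huniq z' hz' f' hf' hfz'] at hfz'
          exact hN.trans (R_symm hN.sy hfx) hfz'
        · filter_upwards [ev_R (hV.nh (j + 3)) x,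
            (closed_coset hNc f).isOpen_compl.mem_nhds hfx] with z' hz' hz'' f' hf' hfz'
          rw [huniq z' hz' f' hf' hfz'] at hfz'
          exact absurd hfz' hz''
      · filter_upwards [ev_R (hV.nh (j + 3)) x] with z' hz' f' hf' hfz'
        exact absurd ⟨z', hz', f', hf', hfz'⟩ hex
    have hfin : ∀ᶠ z in 𝓝 x, ∀ j ∈ Finset.range (m + 3), ∀ f ∈ F j, R N f z → R N x z :=
      (Filter.eventually_all_finset _).2 fun j _ => key j
    filter_upwards [hfin, ev_R (hV.nh (m + 1)) x] with z hz1 hz2 hzB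
    have hnot : z ∉ V (m + 1) := fun hzV =>
      hm (R_zero.1 (hV.tr (R_zero.2 hzV) (R_symm (hV.sy _) hz2)))
    rcases hzB with (hz | ⟨n, f, hf, hz⟩)
    · exact absurd (hNV _ hz) hnot
    · by_cases hn : n < m + 3
      · exact hz1 n (Finset.mem_range.2 hn) f hf hz
      · exfalso
        obtain ⟨k, rfl⟩ : ∃ k, n = k + 1 := ⟨n - 1, by omega⟩
        have hfV : f ∈ V (m + 2) := hV.anti (by omega : m + 2 ≤ k) (hFE (k + 1) hf).2
        exact hnot (R_zero.1 (hV.tr (R_zero.2 hfV) (R_mono (hNV _) hz)))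
  · intro K hK hKc hKB x hxH
    have c1 : ∀ n, ∀ x ∈ E n, ∃ k ∈ K, k ∈ H ∧ R (V n) k x := by
      intro n x hx
      obtain ⟨f, hf, hfx⟩ := hFc n x hx
      have : ∃ k ∈ K, R N f k := by
        by_cases hfN : f ∈ N
        · exact ⟨0, hK.1, hN.R hfN hN.sy.zero⟩
        · exact hKB f (Or.inr ⟨n, f, hf, R_refl hN.sy f⟩) hfN
      obtain ⟨k, hk, hfk⟩ := this
      exact ⟨k, hk, hH.mem (R_mono hNH hfk) (hEH n (hFE n hf)),
        hV.tr (R_symm (hV.sy _) (R_mono (hNV _) hfk)) hfx⟩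
    have c2 : ∀ n, ∃ k ∈ K, k ∈ H ∧ R (V n) k x := by
      intro n
      induction n with
      | zero => exact c1 0 x hxH
      | succ n ih =>
        obtain ⟨k, hk, hkH, hkx⟩ := ih
        obtain ⟨k', hk', hkH', hkx'⟩ := c1 (n + 1) (-k + x) ⟨hH.R hkH hxH, hkx⟩
        refine ⟨k + k', hK.2.1 hk hk', hH.add _ hkH _ hkH', ?_⟩
        have := R_left (hV.sy (n + 1)) k hkx'
        rwa [addn] at this
    have hcl : ∀ n, IsClosed {k | (k ∈ K ∧ k ∈ H) ∧ -k + x ∈ closure (V (n + 1))} := fun n =>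
      (hKc.inter hHc).inter (isClosed_closure.preimage (cright x))
    obtain ⟨k, hk⟩ := IsCompact.nonempty_iInter_of_sequence_nonempty_isCompact_isClosed
      (fun n => {k | (k ∈ K ∧ k ∈ H) ∧ -k + x ∈ closure (V (n + 1))})
      (fun n k hk => ⟨hk.1, closure_mono (hV.anti (by omega)) hk.2⟩)
      (fun n => by
        obtain ⟨k, h1, h2, h3⟩ := c2 (n + 1)
        exact ⟨k, ⟨h1, h2⟩, subset_closure h3⟩)
      (by
        refine (hC.image (cleft x)).of_isClosed_subset (hcl 0) ?_
        rintro k ⟨_, hk⟩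
        have h1 : R (V 0) k x := hV.closure_sub 0 hk
        exact image_mono hVC (coset_sub_image _ x (R_symm (hV.sy 0) h1)))
      hcl
    rw [mem_iInter] at hk
    refine ⟨k, (hk 0).1.1, (hk 0).1.2, ?_⟩
    change -k + x ∈ N
    rw [hNd]
    exact ⟨hH.R (hk 0).1.2 hxH, mem_iInter.2 fun n => hV.closure_sub n (hk n).2⟩

/-- Approximations to a suitable set. -/
structure P (G : Type u) [Gyrogroup G] [TopologicalSpace G] where
  N : Set G
  A : Set G
  sub : ISub N
  cpt : IsCompact N
  cl : IsClosed N
  NA : N ⊆ A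
  sat : ∀ x ∈ A, ∀ z, R N x z → z ∈ A
  disc : ∀ x, x ∉ N → ∀ᶠ z in 𝓝 x, z ∈ A → R N x z
  gen : ∀ K, IsSubgyro K → IsClosed K → (∀ x ∈ A, x ∉ N → ∃ k ∈ K, R N x k) →
    ∀ x, ∃ k ∈ K, R N k x

def P.le (p q : P G) : Prop :=
  q.N ⊆ p.N ∧ q.A ⊆ p.A ∧ ∀ x ∈ p.A, x ∉ p.N →
    ∃ y, R p.N x y ∧ ∀ z, (R p.N x z ∧ z ∈ q.A) ↔ R q.N y z

theorem P.le_refl (p : P G) : P.le p p :=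
  ⟨subset_rfl, subset_rfl, fun x hx _ => ⟨x, R_refl p.sub.sy x, fun z =>
    ⟨fun h => h.1, fun h => ⟨h, p.sat x hx z h⟩⟩⟩⟩

theorem P.le_trans {p q r : P G} (h1 : P.le p q) (h2 : P.le q r) : P.le p r := by
  refine ⟨h2.1.trans h1.1, h2.2.1.trans h1.2.1, fun x hx hxN => ?_⟩
  obtain ⟨y, hxy, hy⟩ := h1.2.2 x hx hxN
  have hyA : y ∈ q.A := ((hy y).2 (R_refl q.sub.sy y)).2
  have hyN : y ∉ q.N := fun h => hxN (p.sub.mem' hxy (h1.1 h))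
  obtain ⟨w, hyw, hw⟩ := h2.2.2 y hyA hyN
  refine ⟨w, p.sub.trans hxy (R_mono h1.1 hyw), fun z => ?_⟩
  rw [← hw, ← hy]
  exact ⟨fun h => ⟨⟨h.1, h2.2.1 h.2⟩, h.2⟩, fun h => ⟨h.1.1, h.2⟩⟩

theorem P.closedA (p : P G) : IsClosed p.A := by
  rw [← isOpen_compl_iff, isOpen_iff_mem_nhds]
  intro x hx
  filter_upwards [p.disc x fun h => hx (p.NA h)] with z hz hzA
  exact hx (p.sat z hzA x (R_symm p.sub.sy (hz hzA)))

theorem P.chain (c : Set (P G)) (hc : IsChain P.le c) (hne : c.Nonempty) :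
    ∃ ub, ∀ a ∈ c, P.le a ub := by
  have htot : ∀ a ∈ c, ∀ b ∈ c, P.le a b ∨ P.le b a := by
    intro a ha b hb
    by_cases h : a = b
    · subst h; exact Or.inl (P.le_refl a)
    · exact hc ha hb h
  obtain ⟨p0, hp0⟩ := hne
  let N : Set G := {x | ∀ p ∈ c, x ∈ p.N}
  let A : Set G := {x | ∀ p ∈ c, x ∈ p.A}
  have hNp : ∀ p ∈ c, N ⊆ p.N := fun p hp x hx => hx p hp
  have hAp : ∀ p ∈ c, A ⊆ p.A := fun p hp x hx => hx p hp
  have hN : ISub N := by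
    refine ⟨⟨fun p _ => p.sub.sy.zero, fun x y v => ?_, fun v hv p hp => p.sub.sy.neg v (hv p hp)⟩,
      fun a ha b hb p hp => p.sub.add a (ha p hp) b (hb p hp)⟩
    exact forall₂_congr fun p _ => p.sub.sy.inv x y v
  have hNcl : IsClosed N := by
    have : N = ⋂ p ∈ c, p.N := by ext x; simp [N]
    rw [this]
    exact isClosed_biInter fun p _ => p.cl
  have hord : ∀ p ∈ c, ∀ x ∈ p.A, x ∉ p.N →
      ∃ y, R p.N x y ∧ ∀ z, (R p.N x z ∧ z ∈ A) ↔ R N y z := by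
    intro p hp x hx hxN
    let I := {q : P G // q ∈ c ∧ P.le p q}
    have : Nonempty I := ⟨⟨p, hp, P.le_refl p⟩⟩
    have hcl : ∀ q : I, IsClosed {z | R p.N x z ∧ z ∈ q.1.A} := fun q =>
      (closed_coset p.cl x).inter q.1.closedA
    obtain ⟨y, hy⟩ := IsCompact.nonempty_iInter_of_directed_nonempty_isCompact_isClosed
      (fun q : I => {z | R p.N x z ∧ z ∈ q.1.A})
      (by
        intro a b
        rcases htot a.1 a.2.1 b.1 b.2.1 with h | h
        · exact ⟨b, fun z hz => ⟨hz.1, h.2.1 hz.2⟩, subset_rfl⟩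
        · exact ⟨a, subset_rfl, fun z hz => ⟨hz.1, h.2.1 hz.2⟩⟩)
      (by
        intro q
        obtain ⟨y, hxy, hy⟩ := q.2.2.2.2 x hx hxN
        exact ⟨y, (hy y).2 (R_refl q.1.sub.sy y)⟩)
      (fun q => (compact_coset p.cpt x).of_isClosed_subset (hcl q) fun z hz => hz.1)
      hcl
    rw [mem_iInter] at hy
    have hxy : R p.N x y := (hy ⟨p, hp, P.le_refl p⟩).1
    have hyA : y ∈ A := by
      intro q hq
      rcases htot p hp q hq with h | h
      · exact (hy ⟨q, hq, h⟩).2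
      · exact h.2.1 (hy ⟨p, hp, P.le_refl p⟩).2
    refine ⟨y, hxy, fun z => ⟨?_, ?_⟩⟩
    · rintro ⟨hz, hzA⟩ q hq
      rcases htot p hp q hq with h | h
      · obtain ⟨w, hxw, hw⟩ := h.2.2 x hx hxN
        exact q.sub.trans (R_symm q.sub.sy ((hw y).1 ⟨hxy, hyA q hq⟩)) ((hw z).1 ⟨hz, hzA q hq⟩)
      · exact h.1 (p.sub.trans (R_symm p.sub.sy hxy) hz)
    · intro hz
      exact ⟨p.sub.trans hxy (hz p hp), fun q hq => q.sat y (hyA q hq) z (hz q hq)⟩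
  refine ⟨⟨N, A, hN, p0.cpt.of_isClosed_subset hNcl (hNp p0 hp0), hNcl,
    fun x hx p hp => p.NA (hx p hp), fun x hx z hz p hp => p.sat x (hx p hp) z (hz p hp),
    ?_, ?_⟩, fun a ha => ⟨hNp a ha, hAp a ha, hord a ha⟩⟩
  · intro x hx
    have : ∃ p ∈ c, x ∉ p.N := by
      by_contra hcon
      push Not at hcon
      exact hx hcon
    obtain ⟨p, hp, hxp⟩ := this
    by_cases hxA : x ∈ p.A
    · obtain ⟨y, hxy, hy⟩ := hord p hp x hxA hxp
      by_cases hyx : R N y x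
      · filter_upwards [p.disc x hxp] with z hz hzA
        exact hN.trans (R_symm hN.sy hyx) ((hy z).1 ⟨hz (hzA p hp), hzA⟩)
      · filter_upwards [p.disc x hxp, (closed_coset hNcl y).isOpen_compl.mem_nhds hyx]
          with z hz hz' hzA
        exact absurd ((hy z).1 ⟨hz (hzA p hp), hzA⟩) hz'
    · filter_upwards [p.closedA.isOpen_compl.mem_nhds hxA] with z hz hzA
      exact absurd (hzA p hp) hz
  · intro K hK hKc hKA x
    have h1 : ∀ p ∈ c, ∃ k ∈ K, R p.N k x := by
      intro p hp
      refine p.gen K hK hKc (fun w hw hwN => ?_) x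
      obtain ⟨y, hwy, hy⟩ := hord p hp w hw hwN
      have hyA : y ∈ A := ((hy y).2 (R_refl hN.sy y)).2
      have hyN : y ∉ N := fun h => hwN (p.sub.mem' hwy (h p hp))
      obtain ⟨k, hk, hyk⟩ := hKA y hyA hyN
      exact ⟨k, hk, p.sub.trans hwy (hyk p hp)⟩
    have : Nonempty c := ⟨⟨p0, hp0⟩⟩
    have hcl : ∀ q : c, IsClosed {k | k ∈ K ∧ R q.1.N k x} := fun q =>
      hKc.inter (q.1.cl.preimage (cright x))
    obtain ⟨k, hk⟩ := IsCompact.nonempty_iInter_of_directed_nonempty_isCompact_isClosed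
      (fun q : c => {k | k ∈ K ∧ R q.1.N k x})
      (by
        intro a b
        rcases htot a.1 a.2 b.1 b.2 with h | h
        · exact ⟨b, fun z hz => ⟨hz.1, h.1 hz.2⟩, subset_rfl⟩
        · exact ⟨a, subset_rfl, fun z hz => ⟨hz.1, h.1 hz.2⟩⟩)
      (fun q => h1 q.1 q.2)
      (fun q => (compact_coset q.1.cpt x).of_isClosed_subset (hcl q)
        fun z hz => R_symm q.1.sub.sy hz.2)
      hcl
    rw [mem_iInter] at hk
    exact ⟨k, (hk ⟨p0, hp0⟩).1, fun p hp => (hk ⟨p, hp⟩).2⟩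

theorem exists_lift {V : ℕ → Set G} (hV : IsSeq V) (C : Set G) : ∃ y, IsCompact C → IsClosed C →
    C.Nonempty → y ∈ C ∧ ∀ n, (C ∩ V n).Nonempty → y ∈ V n := by
  by_cases h : IsCompact C ∧ IsClosed C ∧ C.Nonempty
  swap
  · exact ⟨0, fun h1 h2 h3 => absurd ⟨h1, h2, h3⟩ h⟩
  obtain ⟨hC, hCc, hCn⟩ := h
  suffices ∃ y ∈ C, ∀ n, (C ∩ V n).Nonempty → y ∈ V n by
    obtain ⟨y, h⟩ := this
    exact ⟨y, fun _ _ _ => h⟩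
  by_cases hall : ∀ n, (C ∩ V n).Nonempty
  · have hcl : ∀ n, IsClosed (C ∩ closure (V n)) := fun n => hCc.inter isClosed_closure
    obtain ⟨y, hy⟩ := IsCompact.nonempty_iInter_of_sequence_nonempty_isCompact_isClosed
      (fun n => C ∩ closure (V n))
      (fun n => inter_subset_inter_right _ (closure_mono (hV.anti (by omega))))
      (fun n => (hall n).mono (inter_subset_inter_right _ subset_closure))
      (hC.of_isClosed_subset (hcl 0) inter_subset_left) hcl
    rw [mem_iInter] at hy
    exact ⟨y, (hy 0).1, fun n _ => hV.closure_sub n (hy (n + 1)).2⟩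
  · push Not at hall
    classical
    have hmin := fun m => Nat.find_min hall (m := m)
    have hsp := Nat.find_spec hall
    generalize Nat.find hall = n at hmin hsp
    have hlt : ∀ m, (C ∩ V m).Nonempty → m < n := by
      intro m hm
      by_contra hcon
      have := hm.mono (inter_subset_inter_right C (hV.anti (not_lt.1 hcon)))
      rw [hsp] at this
      exact not_nonempty_empty this
    rcases n with _ | n
    · obtain ⟨y, hy⟩ := hCn
      exact ⟨y, hy, fun m hm => absurd (hlt m hm) (by omega)⟩
    · have : (C ∩ V n).Nonempty := nonempty_iff_ne_empty.2 (hmin n (by omega))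
      obtain ⟨y, hy, hyn⟩ := this
      exact ⟨y, hy, fun m hm => hV.anti (by have := hlt m hm; omega) hyn⟩

theorem P.succ (p : P G) {V : ℕ → Set G} (hV : IsSeq V)
    {C : Set G} (hC : IsCompact C) (hVC : V 0 ⊆ C) :
    ∃ q : P G, P.le p q ∧ q.N ⊆ V 0 := by
  obtain ⟨N, hNd⟩ : ∃ N, N = p.N ∩ ⋂ n, V n := ⟨_, rfl⟩
  obtain ⟨B, hBp, hNB, hBsat, hBd, hBg⟩ := lemX p.sub p.cl hV hC hVC hNd
  have hN : ISub N := hNd ▸ p.sub.inter hV.isub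
  have hNc : IsClosed N := hNd ▸ p.cl.inter hV.closed
  have hNV : ∀ n, N ⊆ V n := fun n => by
    rw [hNd]; exact inter_subset_right.trans (iInter_subset _ n)
  have hNp : N ⊆ p.N := by rw [hNd]; exact inter_subset_left
  choose l hl using exists_lift hV
  let Y : G → G := fun x => l {z | R p.N x z}
  have hY : ∀ x, R p.N x (Y x) ∧ ∀ n, (∃ z, R p.N x z ∧ z ∈ V n) → Y x ∈ V n := fun x =>
    hl {z | R p.N x z} (compact_coset p.cpt x) (closed_coset p.cl x) ⟨x, R_refl p.sub.sy x⟩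
  have hYe : ∀ x x', R p.N x x' → Y x = Y x' := by
    intro x x' h
    have : {z | R p.N x z} = {z | R p.N x' z} := by
      ext z
      exact ⟨fun hz => p.sub.trans (R_symm p.sub.sy h) hz, fun hz => p.sub.trans h hz⟩
    change l _ = l _
    rw [this]
  let A : Set G := {z | z ∈ B ∨ ∃ x ∈ p.A, x ∉ p.N ∧ R N (Y x) z}
  have hRz : ∀ x z, R N (Y x) z → R p.N x z := fun x z h =>
    p.sub.trans (hY x).1 (R_mono hNp h)
  have hord : ∀ x ∈ p.A, x ∉ p.N →
      ∃ y, R p.N x y ∧ ∀ z, (R p.N x z ∧ z ∈ A) ↔ R N y z := by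
    intro x hx hxN
    refine ⟨Y x, (hY x).1, fun z => ⟨?_, fun h => ⟨hRz x z h, Or.inr ⟨x, hx, hxN, h⟩⟩⟩⟩
    rintro ⟨hz, hzB | ⟨x', hx', hxN', hz'⟩⟩
    · exact absurd (p.sub.mem' hz (hBp hzB)) hxN
    · rwa [hYe x x' (p.sub.trans hz (R_symm p.sub.sy (hRz x' z hz')))]
  have hAp : A ⊆ p.A := by
    rintro z (hz | ⟨x, hx, _, hz⟩)
    · exact p.NA (hBp hz)
    · exact p.sat x hx z (hRz x z hz)
  refine ⟨⟨N, A, hN, p.cpt.of_isClosed_subset hNc hNp, hNc, fun x hx => Or.inl (hNB hx),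
    ?_, ?_, ?_⟩, ⟨hNp, hAp, hord⟩, hNV 0⟩
  · rintro x (hx | ⟨w, hw, hwN, hx⟩) z hz
    · exact Or.inl (hBsat x hx z hz)
    · exact Or.inr ⟨w, hw, hwN, hN.trans hx hz⟩
  · intro x hxN
    by_cases hxp : x ∈ p.N
    · have : ∃ m, x ∉ V m := by
        by_contra hcon
        push Not at hcon
        exact hxN (by rw [hNd]; exact ⟨hxp, mem_iInter.2 hcon⟩)
      obtain ⟨m, hm⟩ := this
      have ht : ∀ᶠ z in 𝓝 x, z + -x ∈ V (m + 2) := by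
        have h := (cadd continuous_id continuous_const : Continuous fun z : G => z + -x).tendsto x
        rw [addneg] at h
        exact h (hV.nh _)
      filter_upwards [hBd x hxN, ht, ev_R (hV.nh (m + 1)) x] with z hz1 hz2 hz3 hzA
      rcases hzA with hzB | ⟨w, hw, hwN, hz⟩
      · exact hz1 hzB
      · exfalso
        have h1 : R p.N z (z + -x) := by
          change -z + (z + -x) ∈ p.N
          rw [nadd]
          exact p.sub.sy.neg _ hxp
        have h2 : Y w ∈ V (m + 2) := (hY w).2 (m + 2) ⟨_, p.sub.trans (hRz w z hz) h1, hz2⟩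
        have h3 : R (V (m + 1)) 0 z := hV.tr (R_zero.2 h2) (R_mono (hNV _) hz)
        exact hm (R_zero.1 (hV.tr h3 (R_symm (hV.sy _) hz3)))
    · by_cases hxA : x ∈ p.A
      · obtain ⟨y, hxy, hy⟩ := hord x hxA hxp
        by_cases hyx : R N y x
        · filter_upwards [p.disc x hxp] with z hz hzA
          exact hN.trans (R_symm hN.sy hyx) ((hy z).1 ⟨hz (hAp hzA), hzA⟩)
        · filter_upwards [p.disc x hxp, (closed_coset hNc y).isOpen_compl.mem_nhds hyx]
            with z hz hz' hzA
          exact absurd ((hy z).1 ⟨hz (hAp hzA), hzA⟩) hz'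
      · filter_upwards [p.closedA.isOpen_compl.mem_nhds hxA] with z hz hzA
        exact absurd (hAp hzA) hz
  · intro K hK hKc hKA x
    obtain ⟨k, hk, hkx⟩ := p.gen K hK hKc (fun w hw hwN => by
      obtain ⟨y, hwy, hy⟩ := hord w hw hwN
      have hyA : y ∈ A := ((hy y).2 (R_refl hN.sy y)).2
      have hyN : y ∉ N := fun h => hwN (p.sub.mem' hwy (hNp h))
      obtain ⟨k, hk, hyk⟩ := hKA y hyA hyN
      exact ⟨k, hk, p.sub.trans hwy (R_mono hNp hyk)⟩) x
    obtain ⟨k', hk', _, hkx'⟩ := hBg K hK hKc (fun w hw hwN => hKA w (Or.inl hw) hwN) _ hkx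
    refine ⟨k + k', hK.2.1 hk hk', ?_⟩
    have := R_left hN.sy k hkx'
    rwa [addn] at this

theorem exists_half (hst : StronglyTop G) {W : Set G} (hW : W ∈ 𝓝 (0 : G)) :
    ∃ V, Sy V ∧ V ∈ 𝓝 (0 : G) ∧ V ⊆ W ∧ ∀ a ∈ V, ∀ b ∈ V, a + b ∈ W := by
  obtain ⟨μ, h1, h2, h3⟩ := hst
  have ht := (cont_add (G := G)).tendsto (0, 0)
  simp only [addz] at ht
  have hp := ht hW
  rw [nhds_prod_eq, Filter.mem_map, Filter.mem_prod_same_iff] at hp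
  obtain ⟨T, hT, hTW⟩ := hp
  obtain ⟨U, hU, hUT⟩ := h2 T hT
  have hUi : GInv U := by
    intro x y v
    constructor
    · intro h
      rw [← h3 U hU x y] at h
      obtain ⟨w, hw, he⟩ := h
      rwa [← (Gyrogroup.gyr_bij x y).1 he]
    · intro h
      rw [← h3 U hU x y]
      exact ⟨v, h, rfl⟩
  have hadd : ∀ a ∈ U, ∀ b ∈ U, a + b ∈ W := fun a ha b hb =>
    hTW (mk_mem_prod (hUT ha) (hUT hb))
  have hU0 : (0 : G) ∈ U := mem_of_mem_nhds (h1 U hU)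
  refine ⟨U ∩ {x | -x ∈ U}, ⟨⟨hU0, ?_⟩, ?_, ?_⟩, ?_, ?_, ?_⟩
  · change -(0 : G) ∈ U
    rwa [neg_zero']
  · intro x y v
    refine and_congr (hUi x y v) ?_
    change -gyr x y v ∈ U ↔ -v ∈ U
    rw [← gyr_neg, hUi]
  · rintro v ⟨hv, hv'⟩
    refine ⟨hv', ?_⟩
    change - -v ∈ U
    rwa [negneg]
  · refine Filter.inter_mem (h1 U hU) ?_
    have h := (cont_neg (G := G)).tendsto 0
    rw [neg_zero'] at h
    exact h (h1 U hU)
  · rintro a ⟨ha, _⟩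
    have := hadd a ha 0 hU0
    rwa [addz] at this
  · rintro a ⟨ha, _⟩ b ⟨hb, _⟩
    exact hadd a ha b hb

theorem exists_seq (hst : StronglyTop G) {W : Set G} (hW : W ∈ 𝓝 (0 : G)) :
    ∃ V : ℕ → Set G, IsSeq V ∧ V 0 ⊆ W := by
  choose f hf using fun W : {W : Set G // W ∈ 𝓝 (0 : G)} => exists_half hst W.2
  let g : ℕ → {W : Set G // W ∈ 𝓝 (0 : G)} := fun n =>
    Nat.rec ⟨f ⟨W, hW⟩, (hf _).2.1⟩ (fun _ T => ⟨f T, (hf T).2.1⟩) n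
  refine ⟨fun n => (g n).1, ⟨?_, fun n => (g n).2, fun n => (hf (g n)).2.2.2⟩, (hf ⟨W, hW⟩).2.2.1⟩
  rintro (_ | n)
  · exact (hf ⟨W, hW⟩).1
  · exact (hf (g n)).1

theorem gen_sub (S : Set G) : IsSubgyro (Gyrogroup.gen S) := by
  refine ⟨?_, ?_, ?_, ?_⟩
  · intro T hT; exact hT.1.1
  · intro a b ha hb T hT; exact hT.1.2.1 (ha T hT) (hb T hT)
  · intro a ha T hT; exact hT.1.2.2.1 (ha T hT)
  · intro a b c ha hb hc T hT; exact hT.1.2.2.2 (ha T hT) (hb T hT) (hc T hT)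

theorem closure_sub {K : Set G} (h : IsSubgyro K) : IsSubgyro (closure K) := by
  have hadd : ∀ ⦃a b : G⦄, a ∈ closure K → b ∈ closure K → a + b ∈ closure K := by
    intro a b ha hb
    exact map_mem_closure₂ (f := fun a b : G => a + b) cont_add ha hb
      fun a ha b hb => h.2.1 ha hb
  have hneg : ∀ ⦃a : G⦄, a ∈ closure K → -a ∈ closure K := by
    intro a ha
    exact map_mem_closure cont_neg ha fun a ha => h.2.2.1 ha
  refine ⟨subset_closure h.1, hadd, hneg, ?_⟩
  intro a b c ha hb hc
  rw [gyr_eq]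
  exact hadd (hneg (hadd ha hb)) (hadd ha (hadd hb hc))

theorem main (hst : StronglyTop G) {C : Set G} (hC : IsCompact C) (hC0 : C ∈ 𝓝 (0 : G)) :
    ∃ S : Set G, IsSuitable S := by
  have : T2Space G := TopGyrogroup.t2
  have huniv : ISub (univ : Set G) := ⟨⟨trivial, fun _ _ _ => Iff.rfl, fun _ _ => trivial⟩,
    fun _ _ _ _ => trivial⟩
  have : Nonempty (P G) := by
    obtain ⟨V, hV, hVC⟩ := exists_seq hst hC0
    obtain ⟨B, -, hNB, hBsat, hBd, hBg⟩ := lemX huniv isClosed_univ hV hC hVC rfl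
    have hcl : IsClosed (univ ∩ ⋂ n, V n) := isClosed_univ.inter hV.closed
    exact ⟨⟨univ ∩ ⋂ n, V n, B, huniv.inter hV.isub, hC.of_isClosed_subset hcl
      (inter_subset_right.trans ((iInter_subset _ 0).trans hVC)), hcl, hNB, hBsat, hBd,
      fun K hK hKc hKA x => by
        obtain ⟨k, hk, _, h⟩ := hBg K hK hKc hKA x trivial
        exact ⟨k, hk, h⟩⟩⟩
  obtain ⟨p, hp⟩ := exists_maximal_of_nonempty_chains_bounded (r := P.le (G := G))
    P.chain P.le_trans
  have hN0 : ∀ x ∈ p.N, x = 0 := by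
    intro x hx
    by_contra hne
    obtain ⟨V, hV, hVC⟩ := exists_seq hst
      (Filter.inter_mem hC0 (isOpen_compl_singleton.mem_nhds (Ne.symm hne : (0 : G) ≠ x)))
    obtain ⟨q, hpq, hq⟩ := p.succ hV hC (hVC.trans inter_subset_left)
    exact (hVC (hq ((hp q hpq).1 hx))).2 rfl
  have hR : ∀ x z, R p.N x z → x = z := by
    intro x z h
    have := hN0 _ h
    rw [← addn x z, this, addz]
  have h0 : (0 : G) ∈ p.A := p.NA p.sub.sy.zero
  refine ⟨p.A \ {0}, ?_, ?_, ?_⟩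
  · rw [discreteTopology_subtype_iff]
    rintro x ⟨hxA, hx0⟩
    rw [← Filter.empty_mem_iff_bot, Filter.mem_inf_principal, mem_nhdsWithin_iff_eventually]
    filter_upwards [p.disc x fun h => hx0 (hN0 x h)] with z hz hzx hzA
    exact hzx (hR x z (hz hzA.1)).symm
  · rw [sdiff_union_self, union_eq_self_of_subset_right (singleton_subset_iff.2 h0)]
    exact p.closedA
  · intro x
    obtain ⟨k, hk, hkx⟩ := p.gen (closure (Gyrogroup.gen (p.A \ {0}))) (closure_sub (gen_sub _))
      isClosed_closure (fun w hw hwN => ⟨w, subset_closure fun T hT => hT.2 ⟨hw, fun h => hwN (by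
        rw [mem_singleton_iff.1 h]; exact p.sub.sy.zero)⟩, R_refl p.sub.sy w⟩) x
    rwa [← hR k x hkx]

end topology

end GyroAux

theorem suitable_of_openCompactlyGenerated {G : Type u} [Gyrogroup G] [TopologicalSpace G]
    [TopGyrogroup G] (hst : StronglyTop G)
    (hgen : ∃ U : Set G, IsOpen U ∧ IsCompact (closure U) ∧ gen U = Set.univ) :
    ∃ S : Set G, IsSuitable S := by
  obtain ⟨U, hU, hUc, hUg⟩ := hgen
  rcases U.eq_empty_or_nonempty with rfl | ⟨u, hu⟩
  · have huniv : (Set.univ : Set G) ⊆ {0} := by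
      rw [← hUg]
      refine Set.sInter_subset_of_mem ⟨⟨rfl, ?_, ?_, ?_⟩, Set.empty_subset _⟩
      · rintro a b rfl rfl
        exact GyroAux.addz _
      · rintro a rfl
        exact GyroAux.neg_zero'
      · rintro a b c rfl rfl rfl
        exact GyroAux.gyr_zero _ _
    exact GyroAux.main hst (isCompact_singleton (x := (0 : G)))
      (Filter.mem_of_superset Filter.univ_mem huniv)
  · refine GyroAux.main hst (hUc.image (GyroAux.cleft (-u))) ?_
    have h := (GyroAux.cleft u).tendsto 0
    simp only [GyroAux.addz] at h
    refine Filter.mem_of_superset (h (hU.mem_nhds hu)) ?_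
    intro z hz
    exact ⟨u + z, subset_closure hz, GyroAux.nadd u z⟩
end

section
/- Every locally compact strongly topological gyrogroup has a suitable set. -/
universe u

open Gyrogroup

namespace GyroSol

open Set Filter Topology

section Algebra
variable {G : Type u} [Gyrogroup G]

theorem g_zero_add (x : G) : 0 + x = x := Gyrogroup.zero_add x
theorem g_add_zero (x : G) : x + 0 = x := Gyrogroup.add_zero x
theorem g_neg_add (x : G) : -x + x = 0 := Gyrogroup.neg_add x
theorem g_add_neg (x : G) : x + -x = 0 := Gyrogroup.add_neg x
theorem g_assoc (x y z : G) : x + (y + z) = (x + y) + gyr x y z := Gyrogroup.left_assoc x y z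
theorem g_gyr_add (x y a b : G) : gyr x y (a + b) = gyr x y a + gyr x y b :=
  Gyrogroup.gyr_add x y a b
theorem g_loop (x y : G) : gyr (x + y) y = gyr x y := Gyrogroup.loop x y

theorem g_cancel {x a b : G} (h : x + a = x + b) : a = b := by
  have h2 : -x + (x + a) = -x + (x + b) := by rw [h]
  rw [g_assoc, g_assoc, g_neg_add, g_zero_add, g_zero_add] at h2
  exact (Gyrogroup.gyr_bij _ _).1 h2

theorem g_gyr_zero (y z : G) : gyr 0 y z = z := by
  have h := g_assoc 0 y z
  rw [g_zero_add, g_zero_add] at h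
  exact (g_cancel h).symm

theorem g_neg_add_cancel (x y : G) : -x + (x + y) = y := by
  rw [g_assoc, g_neg_add, g_zero_add, ← g_loop, g_neg_add, g_gyr_zero]

theorem g_neg_neg (x : G) : - -x = x := by
  apply g_cancel (x := -x)
  rw [g_add_neg, g_neg_add]

theorem g_add_neg_cancel (x y : G) : x + (-x + y) = y := by
  have := g_neg_add_cancel (-x) y
  rwa [g_neg_neg] at this

theorem g_neg_zero : -(0 : G) = 0 := by
  have := g_neg_add (0 : G)
  rwa [g_add_zero] at this

theorem g_gyr (x y z : G) : gyr x y z = -(x + y) + (x + (y + z)) := by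
  rw [g_assoc x y z, g_neg_add_cancel]

theorem g_flip (x u : G) : (x + u) + gyr x u (-u) = x := by
  rw [← g_assoc, g_add_neg, g_add_zero]

/-- Invariance under all gyrations. -/
def GInv (N : Set G) : Prop := ∀ x y u : G, gyr x y u ∈ N ↔ u ∈ N

theorem GInv.right {N : Set G} (h : GInv N) (x y : G) {z : G} (hz : z ∈ N) :
    ∃ z' ∈ N, (x + y) + z = x + (y + z') := by
  obtain ⟨z', rfl⟩ := (Gyrogroup.gyr_bij x y).2 z
  exact ⟨z', (h x y z').1 hz, (g_assoc x y z').symm⟩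

/-- Closure under addition and inverse. -/
structure Sub2 (N : Set G) : Prop where
  zero : (0 : G) ∈ N
  add : ∀ a ∈ N, ∀ b ∈ N, a + b ∈ N
  neg : ∀ a ∈ N, -a ∈ N

theorem Sub2.isSubgyro {N : Set G} (h : Sub2 N) : IsSubgyro N := by
  refine ⟨h.zero, fun a b ha hb => h.add a ha b hb, fun a ha => h.neg a ha, ?_⟩
  intro a b c ha hb hc
  rw [g_gyr]
  exact h.add _ (h.neg _ (h.add _ ha _ hb)) _ (h.add _ ha _ (h.add _ hb _ hc))

theorem sub2_gen (A : Set G) : Sub2 (gen A) := by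
  refine ⟨fun S hS => hS.1.1, fun a ha b hb S hS => hS.1.2.1 (ha S hS) (hb S hS),
    fun a ha S hS => hS.1.2.2.1 (ha S hS)⟩

theorem subset_gen (A : Set G) : A ⊆ gen A := fun _ ha _ hS => hS.2 ha

theorem gen_subset {A K : Set G} (hK : Sub2 K) (h : A ⊆ K) : gen A ⊆ K :=
  fun _ ha => ha K ⟨hK.isSubgyro, h⟩

/-- A gyration invariant subgyrogroup. -/
structure GSub (N : Set G) : Prop extends Sub2 N where
  inv : GInv N

theorem GSub.symm {N : Set G} (h : GSub N) {x y : G} (hxy : -x + y ∈ N) : -y + x ∈ N := by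
  have e : x = y + gyr x (-x + y) (-(-x + y)) := by
    have := g_flip x (-x + y)
    rw [g_add_neg_cancel] at this
    exact this.symm
  have : -y + x = gyr x (-x + y) (-(-x + y)) := by
    apply g_cancel (x := y)
    rw [g_add_neg_cancel]
    exact e
  rw [this, h.inv]
  exact h.neg _ hxy

theorem GSub.trans {N : Set G} (h : GSub N) {x y z : G} (hxy : -x + y ∈ N) (hyz : -y + z ∈ N) :
    -x + z ∈ N := by
  obtain ⟨w, hw, e⟩ := h.inv.right x (-x + y) hyz
  rw [g_add_neg_cancel, g_add_neg_cancel] at e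
  rw [e, g_neg_add_cancel]
  exact h.add _ hxy _ hw

theorem gyr_neg (x y a : G) : gyr x y (-a) = -(gyr x y a) := by
  have h0 : gyr x y (0 : G) = 0 := by rw [g_gyr, g_add_zero, g_neg_add]
  apply g_cancel (x := gyr x y a)
  rw [← g_gyr_add, g_add_neg, g_add_neg, h0]

theorem ginv_gen {A : Set G} (h : GInv A) : GInv (gen A) := by
  intro x y
  have h0 : gyr x y (0 : G) = 0 := by rw [g_gyr, g_add_zero, g_neg_add]
  have h1 : gen A ⊆ {u | gyr x y u ∈ Gyrogroup.gen A} := by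
    refine gen_subset ⟨?_, ?_, ?_⟩ ?_
    · rw [mem_ofPred_eq, h0]; exact (sub2_gen A).zero
    · intro a ha b hb
      rw [mem_ofPred_eq, g_gyr_add]; exact (sub2_gen A).add _ ha _ hb
    · intro a ha
      rw [mem_ofPred_eq, gyr_neg]; exact (sub2_gen A).neg _ ha
    · intro a ha
      exact subset_gen A ((h x y a).2 ha)
  have h2 : gen A ⊆ gyr x y '' Gyrogroup.gen A := by
    refine gen_subset ⟨⟨0, (sub2_gen A).zero, h0⟩, ?_, ?_⟩ ?_
    · rintro _ ⟨a, ha, rfl⟩ _ ⟨b, hb, rfl⟩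
      exact ⟨a + b, (sub2_gen A).add _ ha _ hb, g_gyr_add _ _ _ _⟩
    · rintro _ ⟨a, ha, rfl⟩
      exact ⟨-a, (sub2_gen A).neg _ ha, gyr_neg _ _ _⟩
    · intro a ha
      obtain ⟨b, rfl⟩ := (Gyrogroup.gyr_bij x y).2 a
      exact ⟨b, subset_gen A ((h x y b).1 ha), rfl⟩
  intro u
  refine ⟨fun hu => ?_, fun hu => h1 hu⟩
  obtain ⟨v, hv, e⟩ := h2 hu
  rwa [← (Gyrogroup.gyr_bij x y).1 e]

/-- Normality relative to `H`. -/
structure Nrm (H N : Set G) : Prop extends GSub N where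
  sub : N ⊆ H
  nrm : ∀ x ∈ H, ∀ y ∈ H, ∀ m ∈ N, ∀ n ∈ N, -(x + y) + ((x + m) + (y + n)) ∈ N

/-- `K + N` is a subgyrogroup for normal `N`. -/
theorem Nrm.sub2 {H N K : Set G} (hN : Nrm H N) (hK : Sub2 K) (hKH : K ⊆ H) :
    Sub2 {x | ∃ k ∈ K, -k + x ∈ N} := by
  refine ⟨⟨0, hK.zero, ?_⟩, ?_, ?_⟩
  · rw [g_neg_add]; exact hN.zero
  · rintro a ⟨k, hk, hka⟩ b ⟨l, hl, hlb⟩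
    refine ⟨k + l, hK.add _ hk _ hl, ?_⟩
    have := hN.nrm k (hKH hk) l (hKH hl) _ hka _ hlb
    rwa [g_add_neg_cancel, g_add_neg_cancel] at this
  · rintro a ⟨k, hk, hka⟩
    refine ⟨-k, hK.neg _ hk, ?_⟩
    apply hN.toGSub.symm
    have := hN.nrm k (hKH hk) (-k) (hKH (hK.neg _ hk)) _ hka 0 hN.zero
    rw [g_add_neg_cancel, g_add_neg, g_add_zero, g_neg_zero, g_zero_add] at this
    -- a + -k ∈ N
    have e : -a + (a + -k) = -k := g_neg_add_cancel _ _
    rw [← e, g_neg_neg, g_add_neg_cancel]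
    exact this

theorem gyr_left_inv (x y z : G) : -y + (-x + ((x + y) + gyr x y z)) = z := by
  rw [← g_assoc, g_neg_add_cancel, g_neg_add_cancel]

end Algebra

section Top
variable {G : Type u} [Gyrogroup G] [TopologicalSpace G] [TopGyrogroup G]

instance instCA : ContinuousAdd G := ⟨TopGyrogroup.continuous_add⟩
instance instCN : ContinuousNeg G := ⟨TopGyrogroup.continuous_neg⟩
instance instT2 : T2Space G := TopGyrogroup.t2

/-- Small good neighbourhoods. -/
def SB (G : Type u) [Gyrogroup G] [TopologicalSpace G] : Prop :=
  ∀ W ∈ 𝓝 (0 : G), ∃ U ∈ 𝓝 (0 : G), GInv U ∧ IsCompact U ∧ (∀ u ∈ U, -u ∈ U) ∧ U ⊆ W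

theorem continuous_gyr (x y : G) : Continuous (gyr x y) := by
  have : gyr x y = fun z => -(x + y) + (x + (y + z)) := funext (g_gyr x y)
  rw [this]; fun_prop

/-- Gyrations as homeomorphisms. -/
def gyrHomeo (x y : G) : G ≃ₜ G where
  toFun := gyr x y
  invFun z := -y + (-x + ((x + y) + z))
  left_inv z := gyr_left_inv x y z
  right_inv z := by
    rw [g_gyr, g_add_neg_cancel, g_add_neg_cancel, g_neg_add_cancel]
  continuous_toFun := continuous_gyr x y
  continuous_invFun := by fun_prop

theorem GInv.closure {N : Set G} (h : GInv N) : GInv (closure N) := by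
  intro x y u
  have e : gyrHomeo x y ⁻¹' N = N := by ext v; exact h x y v
  have := (gyrHomeo x y).preimage_closure N
  rw [e] at this
  conv_rhs => rw [← this]
  rfl

theorem sb_of [LocallyCompactSpace G] (hst : StronglyTop G) : SB G := by
  obtain ⟨μ, h1, h2, h3⟩ := hst
  intro W hW
  obtain ⟨K, hK, hKW, hKc⟩ := LocallyCompactSpace.local_compact_nhds (0 : G) W hW
  obtain ⟨U, hU, hUK⟩ := h2 K hK
  have hUi : GInv U := by
    intro x y u
    constructor
    · intro hu
      rw [← h3 U hU x y] at hu
      obtain ⟨v, hv, e⟩ := hu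
      rwa [← (Gyrogroup.gyr_bij x y).1 e]
    · intro hu
      rw [← h3 U hU x y]
      exact ⟨u, hu, rfl⟩
  have hcK : closure U ⊆ K := closure_minimal hUK hKc.isClosed
  have hneg : Continuous fun x : G => -x := continuous_neg
  have hcU : closure U ∈ 𝓝 (0 : G) := mem_of_superset (h1 U hU) subset_closure
  refine ⟨closure U ∩ (fun x => -x) ⁻¹' closure U, inter_mem hcU ?_, ?_, ?_, ?_, ?_⟩
  · apply hneg.continuousAt
    show closure U ∈ 𝓝 (-(0 : G))
    rwa [g_neg_zero]
  · intro x y u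
    simp only [mem_inter_iff, mem_preimage]
    rw [← gyr_neg, hUi.closure, hUi.closure]
  · exact (hKc.of_isClosed_subset isClosed_closure hcK).inter_right
      (isClosed_closure.preimage hneg)
  · rintro u ⟨hu, hu'⟩
    refine ⟨hu', ?_⟩
    show - -u ∈ closure U
    rwa [g_neg_neg]
  · exact fun u hu => hKW (hcK hu.1)

theorem nhds_left (c : G) {t : Set G} (ht : t ∈ 𝓝 c) : {u | c + u ∈ t} ∈ 𝓝 (0 : G) := by
  have hc : Continuous fun u : G => c + u := by fun_prop
  apply hc.continuousAt
  show t ∈ 𝓝 (c + 0)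
  rwa [g_add_zero]

theorem nhds_left' (c : G) {W : Set G} (hW : W ∈ 𝓝 (0 : G)) : {y | -c + y ∈ W} ∈ 𝓝 c := by
  have hc : Continuous fun u : G => -c + u := by fun_prop
  apply hc.continuousAt
  show W ∈ 𝓝 (-c + c)
  rwa [g_neg_add]

theorem mem_closure_of (hSB : SB G) {K : Set G} {c : G}
    (h : ∀ W ∈ 𝓝 (0 : G), ∃ k ∈ K, ∃ u ∈ W, c = k + u) : c ∈ closure K := by
  rw [mem_closure_iff_nhds]
  intro t ht
  obtain ⟨U, hU, hUi, -, hUs, hUt⟩ := hSB _ (nhds_left c ht)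
  obtain ⟨k, hk, u, hu, e⟩ := h U hU
  refine ⟨k, ?_, hk⟩
  have : k = c + gyr k u (-u) := by rw [e, g_flip]
  rw [this]
  exact hUt ((hUi _ _ _).2 (hUs _ hu))

theorem of_mem_closure (hSB : SB G) {K : Set G} {c : G} (hc : c ∈ closure K)
    {W : Set G} (hW : W ∈ 𝓝 (0 : G)) : ∃ k ∈ K, ∃ u ∈ W, c = k + u := by
  obtain ⟨U, hU, hUi, -, hUs, hUW⟩ := hSB W hW
  rw [mem_closure_iff_nhds] at hc
  obtain ⟨k, hkU, hk⟩ := hc _ (nhds_left' c hU)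
  refine ⟨k, hk, gyr c (-c + k) (-(-c + k)), hUW ((hUi _ _ _).2 (hUs _ hkU)), ?_⟩
  have := g_flip c (-c + k)
  rw [g_add_neg_cancel] at this
  exact this.symm

theorem Sub2.closure {K : Set G} (h : Sub2 K) : Sub2 (closure K) := by
  refine ⟨subset_closure h.zero, ?_, ?_⟩
  · intro a ha b hb
    exact map_mem_closure₂ continuous_add ha hb h.add
  · intro a ha
    exact map_mem_closure continuous_neg ha h.neg

/-- sets of the form `N + U` with `U` open are open -/
theorem isOpen_addSet (N : Set G) {U : Set G} (hU : IsOpen U) :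
    IsOpen {x | ∃ n ∈ N, -n + x ∈ U} := by
  have : {x | ∃ n ∈ N, -n + x ∈ U} = ⋃ n ∈ N, (fun x => -n + x) ⁻¹' U := by
    ext x; simp
  rw [this]
  refine isOpen_biUnion fun n _ => hU.preimage (by fun_prop)

theorem isOpen_addSet' (N : Set G) {U : Set G} (hU : IsOpen U) :
    IsOpen {x | ∃ n ∈ N, x + n ∈ U} := by
  have : {x | ∃ n ∈ N, x + n ∈ U} = ⋃ n ∈ N, (fun x => x + n) ⁻¹' U := by
    ext x; simp
  rw [this]
  refine isOpen_biUnion fun n _ => hU.preimage (by fun_prop)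

theorem tendsto_shift {ι : Type*} {f f' : ι → G} {l : Filter ι} {N : Set G} (hN : Sub2 N)
    (hc : IsCompact N) (hf : Tendsto f l (𝓝ˢ N)) (h : ∀ d, -(f d) + f' d ∈ N) :
    Tendsto f' l (𝓝ˢ N) := by
  intro W hW
  obtain ⟨O, hO, hNO, hOW⟩ := mem_nhdsSet_iff_exists.1 hW
  have hadd : Continuous fun p : G × G => p.1 + p.2 := continuous_add
  obtain ⟨u, v, hu, hv, hNu, hNv, huv⟩ := generalized_tube_lemma hc hc (hO.preimage hadd) (by
    rintro ⟨a, b⟩ ⟨ha, hb⟩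
    exact hNO (hN.add _ ha _ hb))
  have hev : ∀ᶠ d in l, f d ∈ u := hf (hu.mem_nhdsSet.2 hNu)
  show ∀ᶠ d in l, f' d ∈ W
  filter_upwards [hev] with d hd
  have h2 : (f d, -(f d) + f' d) ∈ u ×ˢ v := ⟨hd, hNv (h d)⟩
  have h3 := huv h2
  simp only [mem_preimage, g_add_neg_cancel] at h3
  exact hOW h3

/-- a decreasing sequence of compact sets -/
theorem seq_small {P W : Set G} {V : ℕ → Set G} (hP : IsClosed P)
    (hV : ∀ n, IsCompact (V n)) (hm : ∀ n, V (n + 1) ⊆ V n) (hW : IsOpen W)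
    (h : P ∩ (⋂ n, V n) ⊆ W) : ∃ n, P ∩ V n ⊆ W := by
  have ha : Antitone V := antitone_nat_of_succ_le hm
  have hc : ∀ n, IsCompact (P ∩ V n) := fun n => (hV n).inter_left hP
  refine exists_subset_nhds_of_isCompact' (V := fun n => P ∩ V n) ?_ hc
    (fun n => (hc n).isClosed) ?_
  · refine Antitone.directed_ge ?_
    intro m n hmn
    exact inter_subset_inter_right _ (ha hmn)
  · intro x hx
    refine hW.mem_nhds (h ?_)
    simp only [mem_iInter, mem_inter_iff] at hx
    exact ⟨(hx 0).1, mem_iInter.2 fun n => (hx n).2⟩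

end Top

section KK
variable {G : Type u} [Gyrogroup G] [TopologicalSpace G] [TopGyrogroup G]

/-- compact invariant neighbourhoods -/
def GoodNhd (V : Set G) : Prop := IsCompact V ∧ GInv V ∧ V ∈ 𝓝 (0 : G)

theorem kk_step (hSB : SB G) {C V : Set G} (hC : IsCompact C) (hV : V ∈ 𝓝 (0 : G)) :
    ∃ V', GoodNhd V' ∧ V' ⊆ V ∧ (∀ x ∈ V', ∀ y ∈ V', x + y ∈ V) ∧ (∀ x ∈ V', -x ∈ V) ∧
      ∀ x ∈ C, ∀ y ∈ C, ∀ u ∈ V', ∀ v ∈ V', -(x + y) + ((x + u) + (y + v)) ∈ V := by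
  have hadd : Continuous fun p : G × G => p.1 + p.2 := continuous_add
  have h1 : (fun p : G × G => p.1 + p.2) ⁻¹' V ∈ 𝓝 ((0 : G), (0 : G)) := by
    apply hadd.continuousAt
    show V ∈ 𝓝 ((0 : G) + 0)
    rwa [g_add_zero]
  rw [nhds_prod_eq, mem_prod_same_iff] at h1
  obtain ⟨A, hA, hAV⟩ := h1
  have hF : Continuous fun p : (G × G) × (G × G) =>
      -(p.1.1 + p.1.2) + ((p.1.1 + p.2.1) + (p.1.2 + p.2.2)) := by fun_prop
  obtain ⟨u, v, hu, hv, hCu, hv0, huv⟩ := generalized_tube_lemma (hC.prod hC)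
    (isCompact_singleton (x := ((0 : G), (0 : G)))) (isOpen_interior.preimage hF) (by
      rintro ⟨⟨x, y⟩, ⟨a, b⟩⟩ ⟨-, hb⟩
      simp only [mem_singleton_iff, Prod.mk.injEq] at hb
      obtain ⟨rfl, rfl⟩ := hb
      show -(x + y) + ((x + 0) + (y + 0)) ∈ interior V
      rw [g_add_zero, g_add_zero, g_neg_add]
      exact mem_interior_iff_mem_nhds.2 hV)
  have h2 : v ∈ 𝓝 ((0 : G), (0 : G)) := hv.mem_nhds (hv0 rfl)
  rw [nhds_prod_eq, mem_prod_same_iff] at h2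
  obtain ⟨B, hB, hBv⟩ := h2
  obtain ⟨U, hU, hUi, hUc, hUs, hUW⟩ := hSB _ (inter_mem (inter_mem hA hB) hV)
  refine ⟨U, ⟨hUc, hUi, hU⟩, fun x hx => (hUW hx).2, ?_, fun x hx => (hUW (hUs x hx)).2, ?_⟩
  · intro x hx y hy
    exact hAV (⟨(hUW hx).1.1, (hUW hy).1.1⟩ : (x, y) ∈ A ×ˢ A)
  · intro x hx y hy a ha b hb
    have : ((x, y), (a, b)) ∈ u ×ˢ v :=
      ⟨hCu ⟨hx, hy⟩, hBv ⟨(hUW ha).1.2, (hUW hb).1.2⟩⟩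
    exact interior_subset (huv this)

theorem kk (hSB : SB G) {H : Set G} {C : ℕ → Set G} (hC : ∀ n, IsCompact (C n))
    (hCm : Monotone C) (hH : H ⊆ ⋃ n, C n) {V0 : Set G} (hV0 : GoodNhd V0) (hV0H : V0 ⊆ H) :
    ∃ V : ℕ → Set G, V 0 = V0 ∧ (∀ n, GoodNhd (V n)) ∧ (∀ n, V (n + 1) ⊆ V n) ∧
      Nrm H (⋂ n, V n) := by
  have hstep : ∀ (n : ℕ) (V : {V : Set G // GoodNhd V}), ∃ V' : {V : Set G // GoodNhd V},
      V'.1 ⊆ V.1 ∧ (∀ x ∈ V'.1, ∀ y ∈ V'.1, x + y ∈ V.1) ∧ (∀ x ∈ V'.1, -x ∈ V.1) ∧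
      ∀ x ∈ C n, ∀ y ∈ C n, ∀ u ∈ V'.1, ∀ v ∈ V'.1, -(x + y) + ((x + u) + (y + v)) ∈ V.1 := by
    intro n V
    obtain ⟨V', h1, h2⟩ := kk_step hSB (hC n) V.2.2.2
    exact ⟨⟨V', h1⟩, h2⟩
  choose next h1 h2 h3 h4 using hstep
  let V : ℕ → {V : Set G // GoodNhd V} := fun n => Nat.rec ⟨V0, hV0⟩ next n
  have hVs : ∀ n, V (n + 1) = next n (V n) := fun n => rfl
  refine ⟨fun n => (V n).1, rfl, fun n => (V n).2, fun n => h1 n (V n), ?_⟩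
  have mem : ∀ {x : G}, x ∈ (⋂ n, (V n).1) ↔ ∀ n, x ∈ (V n).1 := mem_iInter
  refine ⟨⟨⟨?_, ?_, ?_⟩, ?_⟩, ?_, ?_⟩
  · exact mem.2 fun n => mem_of_mem_nhds (V n).2.2.2
  · intro a ha b hb
    rw [mem] at *
    exact fun n => h2 n (V n) a (ha (n + 1)) b (hb (n + 1))
  · intro a ha
    rw [mem] at *
    exact fun n => h3 n (V n) a (ha (n + 1))
  · intro x y u
    rw [mem, mem]
    exact forall_congr' fun n => (V n).2.2.1 x y u
  · exact fun x hx => hV0H (mem.1 hx 0)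
  · intro x hx y hy m hm n hn
    rw [mem] at *
    obtain ⟨i, hi⟩ := mem_iUnion.1 (hH hx)
    obtain ⟨j, hj⟩ := mem_iUnion.1 (hH hy)
    have hVa : Antitone fun n => (V n).1 := antitone_nat_of_succ_le fun n => h1 n (V n)
    intro k
    let l := max k (max i j)
    have hil : i ≤ l := le_trans (le_max_left i j) (le_max_right _ _)
    have hjl : j ≤ l := le_trans (le_max_right i j) (le_max_right _ _)
    have hkl : k ≤ l := le_max_left _ _
    exact hVa hkl (h4 l (V l) x (hCm hil hi) y (hCm hjl hj) m (hm (l + 1)) n (hn (l + 1)))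

/-- A family converging to `P ∩ M` and generating `P ∩ V 0` together with `P ∩ M`. -/
theorem seqgen (hSB : SB G) {P : Set G} (hP : GSub P) (hPc : IsClosed P) {V : ℕ → Set G}
    (hV : ∀ n, GoodNhd (V n)) (hm : ∀ n, V (n + 1) ⊆ V n) :
    ∃ s : ℕ × G → G, (∀ d, s d ∈ P ∩ V 0) ∧ Tendsto s cofinite (𝓝ˢ (P ∩ ⋂ n, V n)) ∧
      P ∩ V 0 ⊆ closure (gen (range s ∪ (P ∩ ⋂ n, V n))) := by
  classical
  have hVa : Antitone V := antitone_nat_of_succ_le hm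
  have hfin : ∀ n, ∃ F : Set G, F.Finite ∧ F ⊆ P ∩ V n ∧
      ∀ c ∈ P ∩ V n, ∃ x ∈ F, -x + c ∈ V (n + 1) := by
    intro n
    have hc : IsCompact (P ∩ V n) := (hV n).1.inter_left hPc
    obtain ⟨t, ht, hcov⟩ := hc.elim_nhds_subcover (fun x => {y | -x + y ∈ V (n + 1)})
      (fun x _ => nhds_left' x (hV (n + 1)).2.2)
    refine ⟨(t : Set G), t.finite_toSet, fun x hx => ht x hx, fun c hc => ?_⟩
    have := hcov hc
    simp only [mem_iUnion] at this
    obtain ⟨x, hx, hxc⟩ := this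
    exact ⟨x, hx, hxc⟩
  choose F hFf hFs hFc using hfin
  have h0 : ∀ n, (0 : G) ∈ P ∩ V n := fun n => ⟨hP.zero, mem_of_mem_nhds (hV n).2.2⟩
  let s : ℕ × G → G := fun d => if d.2 ∈ F d.1 then d.2 else 0
  have hs : ∀ d, s d ∈ P ∩ V d.1 := by
    intro d
    by_cases h : d.2 ∈ F d.1
    · simp only [s, if_pos h]; exact hFs _ h
    · simp only [s, if_neg h]; exact h0 _
  refine ⟨s, fun d => ⟨(hs d).1, hVa (Nat.zero_le _) (hs d).2⟩, ?_, ?_⟩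
  · intro W hW
    obtain ⟨O, hO, hNO, hOW⟩ := mem_nhdsSet_iff_exists.1 hW
    obtain ⟨n, hn⟩ := seq_small hPc (fun n => (hV n).1) hm hO hNO
    show (s ⁻¹' W)ᶜ.Finite
    have hfin2 : (⋃ k ∈ Finset.range n, ({k} : Set ℕ) ×ˢ F k).Finite :=
      Set.Finite.biUnion (Finset.finite_toSet _) fun k _ => (finite_singleton k).prod (hFf k)
    refine hfin2.subset ?_
    rintro ⟨k, x⟩ hk
    have hkW : s (k, x) ∉ O := fun h => hk (hOW h)
    have hkn : k < n := by
      by_contra hcon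
      exact hkW (hn ⟨(hs (k, x)).1, hVa (not_lt.1 hcon) (hs (k, x)).2⟩)
    have hx : x ∈ F k := by
      by_contra hcon
      apply hkW
      have : s (k, x) = 0 := if_neg hcon
      rw [this]
      exact hn (h0 n)
    simp only [mem_iUnion]
    exact ⟨k, Finset.mem_range.2 hkn, rfl, hx⟩
  · intro c hc
    set K := gen (range s ∪ (P ∩ ⋂ n, V n)) with hK
    have hK2 : Sub2 K := sub2_gen _
    have happ : ∀ n, ∃ g ∈ K, ∃ w ∈ P ∩ V n, c = g + w := by
      intro n
      induction n with
      | zero => exact ⟨0, hK2.zero, c, hc, (g_zero_add c).symm⟩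
      | succ n ih =>
        obtain ⟨g, hg, w, hw, e⟩ := ih
        obtain ⟨x, hx, hxw⟩ := hFc n w hw
        have hxK : x ∈ K := subset_gen _ (Or.inl ⟨(n, x), if_pos hx⟩)
        refine ⟨g + x, hK2.add _ hg _ hxK, gyr g x (-x + w), ⟨(hP.inv _ _ _).2
          (hP.add _ (hP.neg _ (hFs n hx).1) _ hw.1), ((hV _).2.1 _ _ _).2 hxw⟩, ?_⟩
        rw [← g_assoc, g_add_neg_cancel, e]
    refine mem_closure_of hSB fun W hW => ?_
    obtain ⟨U, hU, hUi, -, -, hUW⟩ := hSB W hW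
    obtain ⟨n, hn⟩ := seq_small hPc (fun n => (hV n).1) hm
      (isOpen_addSet (P ∩ ⋂ n, V n) (isOpen_interior (s := U))) (by
        intro x hx
        refine ⟨x, hx, ?_⟩
        rw [g_neg_add]
        exact mem_interior_iff_mem_nhds.2 hU)
    obtain ⟨g, hg, w, hw, e⟩ := happ n
    obtain ⟨m, hmm, hmw⟩ := hn hw
    refine ⟨g + m, hK2.add _ hg _ (subset_gen _ (Or.inr hmm)), gyr g m (-m + w),
      hUW ((hUi _ _ _).2 (interior_subset hmw)), ?_⟩
    rw [← g_assoc, g_add_neg_cancel, e]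

/-- Lifting convergence to `N` to convergence to `N ∩ M`. -/
theorem lift_conv {ι : Type*} {N : Set G} (hN : GSub N) (hNc : IsCompact N) {V : ℕ → Set G}
    (hV : ∀ n, GoodNhd (V n)) (hm : ∀ n, V (n + 1) ⊆ V n) {f : ι → G}
    (hf : Tendsto f cofinite (𝓝ˢ N)) :
    ∃ f' : ι → G, (∀ d, -(f d) + f' d ∈ N) ∧ Tendsto f' cofinite (𝓝ˢ (N ∩ ⋂ n, V n)) := by
  classical
  have hVa : Antitone V := antitone_nat_of_succ_le hm
  have hch : ∀ x : G, ∃ y, -x + y ∈ N ∧ ∀ n, (∃ z, -x + z ∈ N ∧ z ∈ V n) → y ∈ V n := by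
    intro x
    have hcont : Continuous fun z : G => -x + z := by fun_prop
    have hcl : IsClosed {z | -x + z ∈ N} := hNc.isClosed.preimage hcont
    by_cases hall : ∀ n, ∃ z, -x + z ∈ N ∧ z ∈ V n
    · have : ({z | -x + z ∈ N} ∩ ⋂ n, V n).Nonempty := by
        by_contra hcon
        rw [not_nonempty_iff_eq_empty] at hcon
        obtain ⟨n, hn⟩ := seq_small hcl (fun n => (hV n).1) hm isOpen_empty hcon.subset
        obtain ⟨z, hz⟩ := hall n
        exact hn hz
      obtain ⟨y, hy, hy2⟩ := this
      exact ⟨y, hy, fun n _ => mem_iInter.1 hy2 n⟩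
    · have hex : ∃ n, ¬ ∃ z, -x + z ∈ N ∧ z ∈ V n := not_forall.1 hall
      have hsp := Nat.find_spec hex
      rcases hn : Nat.find hex with _ | k
      · rw [hn] at hsp
        refine ⟨x, by rw [g_neg_add]; exact hN.zero, ?_⟩
        rintro n ⟨z, hz, hzn⟩
        exact absurd ⟨z, hz, hVa (Nat.zero_le n) hzn⟩ hsp
      · have hk := Nat.find_min hex (m := k) (by omega)
        rw [not_not] at hk
        obtain ⟨y, hy, hyk⟩ := hk
        rw [hn] at hsp
        refine ⟨y, hy, ?_⟩
        rintro n ⟨z, hz, hzn⟩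
        have : n ≤ k := by
          by_contra hcon
          exact hsp ⟨z, hz, hVa (by omega : k + 1 ≤ n) hzn⟩
        exact hVa this hyk
  choose p hp1 hp2 using hch
  refine ⟨fun d => p (f d), fun d => hp1 _, ?_⟩
  have ht := tendsto_shift hN.toSub2 hNc hf (f' := fun d => p (f d)) (fun d => hp1 _)
  intro W hW
  obtain ⟨O, hO, hNO, hOW⟩ := mem_nhdsSet_iff_exists.1 hW
  obtain ⟨n, hn⟩ := seq_small hNc.isClosed (fun n => (hV n).1) hm hO hNO
  have e1 : ∀ᶠ d in cofinite, p (f d) ∈ O ∪ (V n)ᶜ := by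
    refine ht (IsOpen.mem_nhdsSet (hO.union (hV n).1.isClosed.isOpen_compl) |>.2 ?_)
    intro x hx
    by_cases hxV : x ∈ V n
    · exact Or.inl (hn ⟨hx, hxV⟩)
    · exact Or.inr hxV
  have e2 : ∀ᶠ d in cofinite, f d ∈ {x | ∃ n' ∈ N, x + n' ∈ interior (V n)} := by
    refine hf ((isOpen_addSet' N isOpen_interior).mem_nhdsSet.2 ?_)
    intro x hx
    refine ⟨-x, hN.neg _ hx, ?_⟩
    rw [g_add_neg]
    exact mem_interior_iff_mem_nhds.2 (hV n).2.2
  show ∀ᶠ d in cofinite, p (f d) ∈ W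
  filter_upwards [e1, e2] with d h1 h2
  obtain ⟨n', hn', hv⟩ := h2
  have : p (f d) ∈ V n := hp2 _ n ⟨f d + n', by rwa [g_neg_add_cancel], interior_subset hv⟩
  rcases h1 with h1 | h1
  · exact hOW h1
  · exact absurd this h1

end KK

section Main
set_option linter.unusedSectionVars false
variable {G : Type u} [Gyrogroup G] [TopologicalSpace G] [TopGyrogroup G]

/-- Partial approximations to a suitable set of `H`. -/
structure St (H : Set G) where
  N : Set G
  f : Set G × (ℕ × G) → G
  nrm : Nrm H N
  cpt : IsCompact N
  fH : ∀ d, f d ∈ H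
  tend : Tendsto f cofinite (𝓝ˢ N)
  dense : H ⊆ closure (gen (range f ∪ N))
  supp : ∀ d, ¬ N ⊂ d.1 → f d ∈ N

/-- Refinement order. -/
def St.le {H : Set G} (s t : St H) : Prop := t.N ⊆ s.N ∧ ∀ d, -(s.f d) + t.f d ∈ s.N

theorem St.le_refl {H : Set G} (s : St H) : s.le s :=
  ⟨Subset.rfl, fun d => by rw [g_neg_add]; exact s.nrm.zero⟩

theorem St.le_trans {H : Set G} {a b c : St H} (h1 : a.le b) (h2 : b.le c) : a.le c :=
  ⟨h2.1.trans h1.1, fun d => a.nrm.toGSub.trans (h1.2 d) (h1.1 (h2.2 d))⟩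

theorem St.chain (hSB : SB G) {H : Set G} (hH : Sub2 H) (c : Set (St H))
    (hc : ∀ s ∈ c, ∀ t ∈ c, s.le t ∨ t.le s) (hne : c.Nonempty) : ∃ ub : St H, ∀ s ∈ c, s.le ub := by
  have : Nonempty c := hne.to_subtype
  obtain ⟨s0, hs0⟩ := hne
  have hy : ∀ d, ∃ y, ∀ s ∈ c, -(s.f d) + y ∈ s.N := by
    intro d
    have hcomp : ∀ s : c, IsCompact {y | -(s.1.f d) + y ∈ s.1.N} := by
      intro s
      have : {y | -(s.1.f d) + y ∈ s.1.N} = (fun z => s.1.f d + z) '' s.1.N := by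
        ext y
        constructor
        · intro hy
          exact ⟨_, hy, g_add_neg_cancel _ _⟩
        · rintro ⟨z, hz, rfl⟩
          show -(s.1.f d) + (s.1.f d + z) ∈ s.1.N
          rwa [g_neg_add_cancel]
      rw [this]
      exact s.1.cpt.image (by fun_prop)
    have hmono : ∀ s t : c, s.1.le t.1 →
        {y | -(t.1.f d) + y ∈ t.1.N} ⊆ {y | -(s.1.f d) + y ∈ s.1.N} := by
      intro s t hst y hy
      exact s.1.nrm.toGSub.trans (hst.2 d) (hst.1 hy)
    obtain ⟨y, hy⟩ := IsCompact.nonempty_iInter_of_directed_nonempty_isCompact_isClosed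
      (fun s : c => {y | -(s.1.f d) + y ∈ s.1.N}) (by
        intro s t
        rcases hc s.1 s.2 t.1 t.2 with h | h
        · exact ⟨t, hmono _ _ h, Subset.rfl⟩
        · exact ⟨s, Subset.rfl, hmono _ _ h⟩)
      (fun s => ⟨s.1.f d, by
        show -(s.1.f d) + s.1.f d ∈ s.1.N
        rw [g_neg_add]; exact s.1.nrm.zero⟩) hcomp (fun s => (hcomp s).isClosed)
    exact ⟨y, fun s hs => mem_iInter.1 hy ⟨s, hs⟩⟩
  choose f hf using hy
  let N : Set G := ⋂ s : c, s.1.N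
  have mem : ∀ {x : G}, x ∈ N ↔ ∀ s : c, x ∈ s.1.N := mem_iInter
  have hsmall : ∀ O : Set G, IsOpen O → N ⊆ O → ∃ s : c, s.1.N ⊆ O := by
    intro O hO hNO
    refine exists_subset_nhds_of_isCompact' (V := fun s : c => s.1.N) ?_ (fun s => s.1.cpt)
      (fun s => s.1.cpt.isClosed) (fun x hx => hO.mem_nhds (hNO hx))
    intro s t
    rcases hc s.1 s.2 t.1 t.2 with h | h
    · exact ⟨t, h.1, Subset.rfl⟩
    · exact ⟨s, Subset.rfl, h.1⟩
  have hNsub : ∀ s ∈ c, N ⊆ s.N := fun s hs x hx => mem.1 hx ⟨s, hs⟩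
  have hNc : IsCompact N :=
    s0.cpt.of_isClosed_subset (isClosed_iInter fun s => s.1.cpt.isClosed) (hNsub s0 hs0)
  have hN : Nrm H N := by
    refine ⟨⟨⟨?_, ?_, ?_⟩, ?_⟩, ?_, ?_⟩
    · exact mem.2 fun s => s.1.nrm.zero
    · intro a ha b hb
      rw [mem] at *
      exact fun s => s.1.nrm.add _ (ha s) _ (hb s)
    · intro a ha
      rw [mem] at *
      exact fun s => s.1.nrm.neg _ (ha s)
    · intro x y u
      rw [mem, mem]
      exact forall_congr' fun s => s.1.nrm.inv x y u
    · exact (hNsub s0 hs0).trans s0.nrm.sub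
    · intro x hx y hy m hm n hn
      rw [mem] at *
      exact fun s => s.1.nrm.nrm x hx y hy m (hm s) n (hn s)
  have hfH : ∀ d, f d ∈ H := by
    intro d
    have := hH.add _ (s0.fH d) _ (s0.nrm.sub (hf d s0 hs0))
    rwa [g_add_neg_cancel] at this
  refine ⟨⟨N, f, hN, hNc, hfH, ?_, ?_, ?_⟩, fun s hs => ⟨hNsub s hs, fun d => hf d s hs⟩⟩
  · intro W hW
    obtain ⟨O, hO, hNO, hOW⟩ := mem_nhdsSet_iff_exists.1 hW
    obtain ⟨s, hs⟩ := hsmall O hO hNO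
    have := tendsto_shift s.1.nrm.toSub2 s.1.cpt s.1.tend (fun d => hf d s.1 s.2)
    exact this (mem_of_superset (hO.mem_nhdsSet.2 hs) hOW)
  · intro x hx
    set K := gen (range f ∪ N) with hK
    have hK2 : Sub2 K := sub2_gen _
    have hKH : K ⊆ H := gen_subset hH (by
      rintro _ (⟨d, rfl⟩ | h)
      · exact hfH d
      · exact hN.sub h)
    refine mem_closure_of hSB fun W hW => ?_
    obtain ⟨W', hW', -, hWadd, -⟩ := kk_step hSB (isCompact_empty (X := G)) hW
    obtain ⟨U, hU, hUi, -, -, hUW⟩ := hSB W' hW'.2.2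
    obtain ⟨s, hs⟩ := hsmall _ (isOpen_addSet N (isOpen_interior (s := U))) (by
        intro x hx
        refine ⟨x, hx, ?_⟩
        rw [g_neg_add]
        exact mem_interior_iff_mem_nhds.2 hU)
    have hT := s.1.nrm.sub2 hK2 hKH
    have hgT : gen (range s.1.f ∪ s.1.N) ⊆ {x | ∃ k ∈ K, -k + x ∈ s.1.N} := by
      refine gen_subset hT ?_
      rintro _ (⟨d, rfl⟩ | h)
      · exact ⟨f d, subset_gen _ (Or.inl ⟨d, rfl⟩), s.1.nrm.toGSub.symm (hf d s.1 s.2)⟩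
      · refine ⟨0, hK2.zero, ?_⟩
        rwa [g_neg_zero, g_zero_add]
    obtain ⟨t, ht, u, hu, e⟩ := of_mem_closure hSB (s.1.dense hx) hU
    obtain ⟨k, hk, hkt⟩ := hgT ht
    obtain ⟨n, hn, hnu⟩ := hs hkt
    have e1 : t = (k + n) + gyr k n (-n + (-k + t)) := by
      rw [← g_assoc, g_add_neg_cancel, g_add_neg_cancel]
    obtain ⟨u', hu', e2⟩ := hUi.right (k + n) (gyr k n (-n + (-k + t))) hu
    refine ⟨k + n, hK2.add _ hk _ (subset_gen _ (Or.inr hn)),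
      gyr k n (-n + (-k + t)) + u', ?_, ?_⟩
    rotate_left
    · rw [e, ← e2, ← e1]
    · exact hWadd _ (hUW ((hUi _ _ _).2 (interior_subset hnu))) _ (hUW hu')
  · intro d hd
    rw [mem]
    intro s
    have h1 : s.1.f d ∈ s.1.N := s.1.supp d fun h => hd (lt_of_le_of_lt (hNsub s.1 s.2) h)
    have := s.1.nrm.add _ h1 _ (hf d s.1 s.2)
    rwa [g_add_neg_cancel] at this

theorem St.step (hSB : SB G) {H : Set G} (hH : Sub2 H) (hHn : H ∈ 𝓝 (0 : G)) {C : ℕ → Set G}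
    (hC : ∀ n, IsCompact (C n)) (hCm : Monotone C) (hHC : H ⊆ ⋃ n, C n) (s : St H) {x : G}
    (hx : x ∈ s.N) (hx0 : x ≠ 0) : ∃ t : St H, s.le t ∧ x ∉ t.N := by
  classical
  obtain ⟨V0, hV0, hV0i, hV0c, -, hV0s⟩ := hSB _ (inter_mem hHn (isOpen_ne.mem_nhds hx0.symm))
  obtain ⟨T, hTz, hT, hTm, hM0⟩ := kk hSB hC hCm hHC (V0 := V0) ⟨hV0c, hV0i, hV0⟩
    fun y hy => (hV0s hy).1
  have h0V0 : (0 : G) ∈ V0 := mem_of_mem_nhds hV0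
  let Q : Set G := (fun p : G × G => p.1 + p.2) '' (s.N ×ˢ V0)
  have hNQ : s.N ⊆ Q := fun y hy => ⟨(y, 0), ⟨hy, h0V0⟩, g_add_zero y⟩
  have hVQ : V0 ⊆ Q := fun y hy => ⟨(0, y), ⟨s.nrm.zero, hy⟩, g_zero_add y⟩
  have hQ : GoodNhd Q := by
    refine ⟨(s.cpt.prod hV0c).image continuous_add, ?_, mem_of_superset hV0 hVQ⟩
    intro a b u
    constructor
    · rintro ⟨⟨n, v⟩, ⟨hn, hv⟩, e⟩
      obtain ⟨n', rfl⟩ := (Gyrogroup.gyr_bij a b).2 n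
      obtain ⟨v', rfl⟩ := (Gyrogroup.gyr_bij a b).2 v
      refine ⟨(n', v'), ⟨(s.nrm.inv a b n').1 hn, (hV0i a b v').1 hv⟩, ?_⟩
      apply (Gyrogroup.gyr_bij a b).1
      rw [← e, g_gyr_add]
    · rintro ⟨⟨n, v⟩, ⟨hn, hv⟩, rfl⟩
      exact ⟨(gyr a b n, gyr a b v), ⟨(s.nrm.inv a b n).2 hn, (hV0i a b v).2 hv⟩,
        (g_gyr_add a b n v).symm⟩
  obtain ⟨V, hVz, hVs⟩ : ∃ V : ℕ → Set G, V 0 = Q ∧ ∀ n, V (n + 1) = T n :=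
    ⟨fun n => Nat.casesOn n Q T, rfl, fun _ => rfl⟩
  have hV : ∀ n, GoodNhd (V n) := by
    rintro (_ | n)
    · rw [hVz]; exact hQ
    · rw [hVs]; exact hT n
  have hm : ∀ n, V (n + 1) ⊆ V n := by
    rintro (_ | n)
    · rw [hVs, hVz, hTz]; exact hVQ
    · rw [hVs, hVs]; exact hTm n
  have hM : Nrm H (⋂ n, V n) := by
    have : (⋂ n, V n) = ⋂ n, T n := by
      apply Subset.antisymm
      · intro y hy
        refine mem_iInter.2 fun n => ?_
        rw [← hVs]; exact mem_iInter.1 hy _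
      · intro y hy
        refine mem_iInter.2 ?_
        have h1 : ∀ n, y ∈ V (n + 1) := fun n => by rw [hVs]; exact mem_iInter.1 hy n
        rintro (_ | n)
        · exact hm 0 (h1 0)
        · exact h1 n
    rw [this]; exact hM0
  obtain ⟨q, hq1, hq2, hq3⟩ := seqgen hSB s.nrm.toGSub s.cpt.isClosed hV hm
  obtain ⟨p, hp1, hp2⟩ := lift_conv s.nrm.toGSub s.cpt hV hm s.tend
  set M : Set G := ⋂ n, V n with hMdef
  have hxM : x ∉ M := fun h => by
    have := mem_iInter.1 h 1
    rw [hVs, hTz] at this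
    exact (hV0s this).2 rfl
  have hN' : Nrm H (s.N ∩ M) := by
    refine ⟨⟨⟨⟨s.nrm.zero, hM.zero⟩, ?_, ?_⟩, ?_⟩, fun y hy => s.nrm.sub hy.1, ?_⟩
    · exact fun a ha b hb => ⟨s.nrm.add _ ha.1 _ hb.1, hM.add _ ha.2 _ hb.2⟩
    · exact fun a ha => ⟨s.nrm.neg _ ha.1, hM.neg _ ha.2⟩
    · exact fun x y u => and_congr (s.nrm.inv x y u) (hM.inv x y u)
    · exact fun x hx y hy m hm n hn =>
        ⟨s.nrm.nrm x hx y hy m hm.1 n hn.1, hM.nrm x hx y hy m hm.2 n hn.2⟩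
  have hcl : IsClosed M := isClosed_iInter fun n => (hV n).1.isClosed
  let f : Set G × (ℕ × G) → G := fun d =>
    if s.N ⊂ d.1 then p d else if d.1 = s.N then q d.2 else 0
  have hf1 : ∀ d, s.N ⊂ d.1 → f d = p d := fun d hd => if_pos hd
  have hf2 : ∀ e, f (s.N, e) = q e := fun e => by
    simp only [f]
    rw [if_neg (ssubset_irrefl _)]
    simp
  have hf3 : ∀ d, ¬ s.N ⊂ d.1 → d.1 ≠ s.N → f d = 0 := fun d h1 h2 => by
    simp only [f]
    rw [if_neg h1, if_neg h2]
  have hfN : ∀ d, ¬ s.N ⊂ d.1 → f d ∈ s.N := by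
    intro d hd
    by_cases h : d.1 = s.N
    · have : d = (s.N, d.2) := by rw [← h]
      rw [this, hf2]
      exact (hq1 _).1
    · rw [hf3 d hd h]
      exact s.nrm.zero
  have hle : ∀ d, -(s.f d) + f d ∈ s.N := by
    intro d
    by_cases h : s.N ⊂ d.1
    · rw [hf1 d h]; exact hp1 d
    · exact s.nrm.add _ (s.nrm.neg _ (s.supp d h)) _ (hfN d h)
  refine ⟨⟨s.N ∩ M, f, hN', s.cpt.inter_right hcl, ?_, ?_, ?_, ?_⟩,
    ⟨inter_subset_left, hle⟩, fun h => hxM h.2⟩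
  · intro d
    have := hH.add _ (s.fH d) _ (s.nrm.sub (hle d))
    rwa [g_add_neg_cancel] at this
  · intro W hW
    have e1 : (p ⁻¹' W)ᶜ.Finite := hp2 hW
    have e2 : (q ⁻¹' W)ᶜ.Finite := hq2 hW
    show (f ⁻¹' W)ᶜ.Finite
    refine (e1.union (e2.image fun e => (s.N, e))).subset ?_
    intro d hd
    have hd' : f d ∉ W := hd
    by_cases h : s.N ⊂ d.1
    · left
      rw [hf1 d h] at hd'
      exact hd'
    · right
      by_cases h2 : d.1 = s.N
      · have e : d = (s.N, d.2) := by rw [← h2]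
        rw [e, hf2] at hd'
        exact ⟨d.2, hd', e.symm⟩
      · rw [hf3 d h h2] at hd'
        exact absurd (subset_of_mem_nhdsSet hW hN'.zero) hd'
  · have hK2 : Sub2 (closure (gen (range f ∪ s.N ∩ M))) := (sub2_gen _).closure
    have hqK : gen (range q ∪ s.N ∩ M) ⊆ gen (range f ∪ s.N ∩ M) := by
      refine gen_subset (sub2_gen _) ?_
      rintro _ (⟨e, rfl⟩ | h)
      · exact subset_gen _ (Or.inl ⟨(s.N, e), hf2 e⟩)
      · exact subset_gen _ (Or.inr h)
    have hVK : s.N ∩ V 0 ⊆ closure (gen (range f ∪ s.N ∩ M)) := hq3.trans (closure_mono hqK)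
    have hNK : s.N ⊆ closure (gen (range f ∪ s.N ∩ M)) := by
      intro y hy
      refine hVK ⟨hy, ?_⟩
      rw [hVz]; exact hNQ hy
    refine s.dense.trans (closure_minimal (gen_subset hK2 ?_) isClosed_closure)
    rintro _ (⟨d, rfl⟩ | h)
    · have h1 := s.nrm.toGSub.symm (hle d)
      have h2 := hK2.add _ (subset_closure (subset_gen _ (Or.inl ⟨d, rfl⟩) :
        f d ∈ gen (range f ∪ s.N ∩ M))) _ (hNK h1)
      rwa [g_add_neg_cancel] at h2
    · exact hNK h
  · intro d hd
    by_cases h : s.N ⊂ d.1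
    · exact absurd (lt_of_le_of_lt (inter_subset_left : s.N ∩ M ⊆ s.N) h) hd
    · by_cases h2 : d.1 = s.N
      · exfalso
        apply hd
        rw [h2]
        exact ⟨inter_subset_left, fun h' => hxM (h' hx).2⟩
      · rw [hf3 d h h2]; exact hN'.zero

theorem St.base (hSB : SB G) {H : Set G} (hH : Sub2 H) {C : ℕ → Set G}
    (hC : ∀ n, IsCompact (C n)) (hCm : Monotone C) (hHC : H ⊆ ⋃ n, C n) {V0 : Set G}
    (hV0 : GoodNhd V0) (hV0H : V0 ⊆ H) (hgen : H ⊆ gen V0) : Nonempty (St H) := by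
  classical
  obtain ⟨V, hVz, hV, hm, hM⟩ := kk hSB hC hCm hHC hV0 hV0H
  have huniv : GSub (univ : Set G) :=
    ⟨⟨mem_univ _, fun _ _ _ _ => mem_univ _, fun _ _ => mem_univ _⟩,
      fun _ _ _ => ⟨fun _ => mem_univ _, fun _ => mem_univ _⟩⟩
  obtain ⟨q, hq1, hq2, hq3⟩ := seqgen hSB huniv isClosed_univ hV hm
  rw [univ_inter] at hq2 hq3
  simp only [univ_inter] at hq1
  rw [hVz] at hq1 hq3
  let f : Set G × (ℕ × G) → G := fun d => if d.1 = univ then q d.2 else 0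
  have hf1 : ∀ e, f (univ, e) = q e := fun e => if_pos rfl
  have hf2 : ∀ d, d.1 ≠ univ → f d = 0 := fun d hd => if_neg hd
  refine ⟨⟨⋂ n, V n, f, hM, (hV 0).1.of_isClosed_subset
    (isClosed_iInter fun n => (hV n).1.isClosed) (iInter_subset _ 0), ?_, ?_, ?_, ?_⟩⟩
  · rintro ⟨P, e⟩
    by_cases h : P = univ
    · rw [h, hf1]; exact hV0H (hq1 e)
    · rw [hf2 _ h]; exact hH.zero
  · intro W hW
    have e2 : (q ⁻¹' W)ᶜ.Finite := hq2 hW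
    show (f ⁻¹' W)ᶜ.Finite
    refine (e2.image fun e => ((univ : Set G), e)).subset ?_
    rintro ⟨P, e⟩ hd
    have hd' : f (P, e) ∉ W := hd
    by_cases h : P = univ
    · subst h
      rw [hf1] at hd'
      exact ⟨e, hd', rfl⟩
    · rw [hf2 _ h] at hd'
      exact absurd (subset_of_mem_nhdsSet hW hM.zero) hd'
  · refine hgen.trans (gen_subset (sub2_gen _).closure (hq3.trans (closure_mono ?_)))
    refine gen_subset (sub2_gen _) ?_
    rintro _ (⟨e, rfl⟩ | h)
    · exact subset_gen _ (Or.inl ⟨(univ, e), hf1 e⟩)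
    · exact subset_gen _ (Or.inr h.2)
  · rintro ⟨P, e⟩ hd
    by_cases h : P = univ
    · subst h
      have : (⋂ n, V n) = univ := by
        by_contra hcon
        exact hd (ssubset_univ_iff.2 hcon)
      rw [this]; exact mem_univ _
    · rw [hf2 _ h]; exact hM.zero

/-- The subgyrogroup generated by a compact set is σ-compact. -/
theorem gen_sigma {A : Set G} (hA : IsCompact A) (h0 : (0 : G) ∈ A) :
    ∃ C : ℕ → Set G, (∀ n, IsCompact (C n)) ∧ Monotone C ∧ gen A ⊆ ⋃ n, C n := by
  let st : Set G → Set G := fun B => (B ∪ (fun p : G × G => p.1 + p.2) '' (B ×ˢ B)) ∪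
    (fun x => -x) '' B
  let C : ℕ → Set G := fun n => st^[n] A
  have hCs : ∀ n, C (n + 1) = st (C n) := fun n => Function.iterate_succ_apply' st n A
  have hm : Monotone C := by
    refine monotone_nat_of_le_succ fun n => ?_
    rw [hCs]
    exact fun x hx => Or.inl (Or.inl hx)
  refine ⟨C, ?_, hm, ?_⟩
  · intro n
    induction n with
    | zero => exact hA
    | succ n ih =>
      rw [hCs]
      exact (ih.union ((ih.prod ih).image continuous_add)).union (ih.image continuous_neg)
  · refine gen_subset ⟨mem_iUnion.2 ⟨0, h0⟩, ?_, ?_⟩ (subset_iUnion C 0)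
    · intro a ha b hb
      obtain ⟨i, hi⟩ := mem_iUnion.1 ha
      obtain ⟨j, hj⟩ := mem_iUnion.1 hb
      refine mem_iUnion.2 ⟨max i j + 1, ?_⟩
      rw [hCs]
      exact Or.inl (Or.inr ⟨(a, b), ⟨hm (le_max_left i j) hi, hm (le_max_right i j) hj⟩, rfl⟩)
    · intro a ha
      obtain ⟨i, hi⟩ := mem_iUnion.1 ha
      refine mem_iUnion.2 ⟨i + 1, ?_⟩
      rw [hCs]
      exact Or.inr ⟨a, hi, rfl⟩

theorem exists_family (hSB : SB G) : ∃ (H : Set G) (ι : Type u) (f : ι → G), GSub H ∧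
    H ∈ 𝓝 (0 : G) ∧ (∀ d, f d ∈ H) ∧ Tendsto f cofinite (𝓝 (0 : G)) ∧
    H ⊆ closure (gen (range f)) := by
  obtain ⟨V0, hV0, hV0i, hV0c, -, -⟩ := hSB univ univ_mem
  have h00 : (0 : G) ∈ V0 := mem_of_mem_nhds hV0
  obtain ⟨C, hC, hCm, hHC⟩ := gen_sigma hV0c h00
  have hH : Sub2 (gen V0) := sub2_gen V0
  have hHn : gen V0 ∈ 𝓝 (0 : G) := mem_of_superset hV0 (subset_gen V0)
  obtain ⟨s0⟩ := St.base hSB hH hC hCm hHC ⟨hV0c, hV0i, hV0⟩ (subset_gen V0) Subset.rfl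
  obtain ⟨m, hmax⟩ := exists_maximal_of_chains_bounded (r := St.le (H := gen V0)) (by
    intro c hc
    rcases c.eq_empty_or_nonempty with rfl | hne
    · exact ⟨s0, fun a ha => absurd ha (notMem_empty a)⟩
    · refine St.chain hSB hH c ?_ hne
      intro s hs t ht
      by_cases h : s = t
      · subst h; exact Or.inl s.le_refl
      · exact hc hs ht h) (fun h1 h2 => St.le_trans h1 h2)
  have hN : m.N = {0} := by
    apply Subset.antisymm
    · intro x hx
      by_contra hx0
      obtain ⟨t, ht, hxt⟩ := St.step hSB hH hHn hC hCm hHC m hx hx0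
      exact hxt ((hmax t ht).1 hx)
    · rintro _ rfl
      exact m.nrm.zero
  have h1 := m.tend
  have h2 := m.dense
  rw [hN] at h1 h2
  rw [nhdsSet_singleton] at h1
  refine ⟨gen V0, _, m.f, ⟨hH, ginv_gen hV0i⟩, hHn, m.fH, h1, h2.trans (closure_mono ?_)⟩
  refine gen_subset (sub2_gen _) ?_
  rintro x (h | h)
  · exact subset_gen _ h
  · rw [mem_singleton_iff.1 h]; exact (sub2_gen _).zero

theorem suitable_top {S : Set G} (h : ∀ y : G, y ≠ 0 → ∃ W ∈ 𝓝 y, (W ∩ S).Finite)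
    (h0 : (0 : G) ∉ S) : DiscreteTopology S ∧ IsClosed (S ∪ {(0 : G)}) := by
  constructor
  · rw [discreteTopology_subtype_iff]
    intro x hx
    obtain ⟨W, hW, hfin⟩ := h x (fun e => h0 (e ▸ hx))
    rw [inf_principal_eq_bot]
    have h1 : ((W ∩ S) \ {x})ᶜ ∈ 𝓝 x :=
      (hfin.subset diff_subset).isClosed.isOpen_compl.mem_nhds fun hh => hh.2 rfl
    filter_upwards [mem_nhdsWithin_of_mem_nhds hW, mem_nhdsWithin_of_mem_nhds h1,
      self_mem_nhdsWithin] with y hyW hy1 hyx hyS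
    exact hy1 ⟨⟨hyW, hyS⟩, hyx⟩
  · rw [← isOpen_compl_iff, isOpen_iff_mem_nhds]
    intro x hx
    have hx0 : x ≠ 0 := fun e => hx (Or.inr e)
    obtain ⟨W, hW, hfin⟩ := h x hx0
    have h1 : (W ∩ S)ᶜ ∈ 𝓝 x := hfin.isClosed.isOpen_compl.mem_nhds fun hh => hx (Or.inl hh.2)
    filter_upwards [hW, h1, isOpen_ne.mem_nhds hx0] with y hyW hyS hy0
    rintro (hy | hy)
    · exact hyS ⟨hyW, hy⟩
    · exact hy0 hy

theorem main (hSB : SB G) : ∃ S : Set G, IsSuitable S := by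
  classical
  obtain ⟨H, ι, f, hH, hHn, hfH, hft, hfd⟩ := exists_family hSB
  have hcos : ∀ {x y : G}, -x + y ∈ H → {z | -x + z ∈ H} = {z | -y + z ∈ H} := by
    intro x y hxy
    ext z
    exact ⟨fun h => hH.trans (hH.symm hxy) h, fun h => hH.trans hxy h⟩
  have hself : ∀ x : G, -x + x ∈ H := fun x => by rw [g_neg_add]; exact hH.zero
  let r : G → G := fun x => Classical.epsilon fun z => z ∈ {z | -x + z ∈ H}
  have hr : ∀ x, -x + r x ∈ H := fun x =>
    Classical.epsilon_spec (p := fun z => z ∈ {z | -x + z ∈ H}) ⟨x, hself x⟩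
  have hreq : ∀ {x y : G}, -x + y ∈ H → r x = r y := by
    intro x y hxy
    simp only [r]
    rw [hcos hxy]
  have hzero : ∀ {x : G}, -(0 : G) + x ∈ H ↔ x ∈ H := by
    intro x; rw [g_neg_zero, g_zero_add]
  let S : Set G := (range f \ {0}) ∪ r '' Hᶜ
  have hrH : ∀ x, x ∉ H → r x ∉ H := by
    intro x hx h
    exact hx (hzero.1 (hH.trans (hzero.2 h) (hH.symm (hr x))))
  have h0S : (0 : G) ∉ S := by
    rintro (⟨-, h⟩ | ⟨x, hx, e⟩)
    · exact h rfl
    · exact hrH x hx (e ▸ hH.zero)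
  have hloc : ∀ y : G, y ≠ 0 → ∃ W ∈ 𝓝 y, (W ∩ S).Finite := by
    intro y hy
    by_cases hyH : y ∈ H
    · obtain ⟨A, B, hA, hB, hyA, h0B, hAB⟩ := t2_separation hy
      have hfin : (f ⁻¹' B)ᶜ.Finite := hft (hB.mem_nhds h0B)
      refine ⟨A ∩ {z | -y + z ∈ H}, inter_mem (hA.mem_nhds hyA) (nhds_left' y hHn), ?_⟩
      refine (hfin.image f).subset ?_
      rintro z ⟨⟨hzA, hzH⟩, ⟨⟨d, rfl⟩, -⟩ | ⟨x, hx, rfl⟩⟩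
      · exact ⟨d, fun hd => Set.disjoint_left.1 hAB hzA hd, rfl⟩
      · exact absurd (hzero.1 (hH.trans (hzero.2 hyH) hzH)) (hrH x hx)
    · refine ⟨{z | -y + z ∈ H}, nhds_left' y hHn, (finite_singleton (r y)).subset ?_⟩
      rintro z ⟨hzH, ⟨⟨d, rfl⟩, -⟩ | ⟨x, hx, rfl⟩⟩
      · exact absurd (hzero.1 (hH.trans (hzero.2 (hfH d)) (hH.symm hzH))) hyH
      · exact (hreq (hH.trans hzH (hH.symm (hr x)))).symm
  obtain ⟨h1, h2⟩ := suitable_top hloc h0S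
  refine ⟨S, h1, h2, ?_⟩
  have hK : Sub2 (closure (gen S)) := (sub2_gen S).closure
  have hHK : H ⊆ closure (gen S) := by
    refine hfd.trans (closure_minimal ?_ isClosed_closure)
    refine gen_subset hK ?_
    rintro _ ⟨d, rfl⟩
    by_cases hd : f d = 0
    · rw [hd]; exact hK.zero
    · exact subset_closure (subset_gen S (Or.inl ⟨⟨d, rfl⟩, hd⟩))
  intro x
  by_cases hx : x ∈ H
  · exact hHK hx
  · have a1 : r x ∈ closure (gen S) := subset_closure (subset_gen S (Or.inr ⟨x, hx, rfl⟩))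
    have a2 := hK.add _ a1 _ (hHK (hH.symm (hr x)))
    rwa [g_add_neg_cancel] at a2

end Main

end GyroSol

theorem locallyCompact_strongly_suitable {G : Type u} [Gyrogroup G] [TopologicalSpace G]
    [TopGyrogroup G] [LocallyCompactSpace G] (hst : StronglyTop G) :
    ∃ S : Set G, IsSuitable S := by
  exact GyroSol.main (GyroSol.sb_of hst)
end

section
/- Every compact strongly topological gyrogroup has a suitable set. -/
universe u

namespace Gyrogroup

open Filter Topology

section alg
variable {G : Type u} [Gyrogroup G]

lemma zadd (x : G) : 0 + x = x := Gyrogroup.zero_add x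
lemma addz (x : G) : x + 0 = x := Gyrogroup.add_zero x
lemma nadd (x : G) : -x + x = 0 := Gyrogroup.neg_add x
lemma addn (x : G) : x + -x = 0 := Gyrogroup.add_neg x
lemma lassoc (x y z : G) : x + (y + z) = (x + y) + gyr x y z := Gyrogroup.left_assoc x y z

lemma lcancel {x y z : G} (h : x + y = x + z) : y = z := by
  have h1 : -x + (x + y) = -x + (x + z) := by rw [h]
  rw [lassoc, lassoc, nadd, zadd, zadd] at h1
  exact (gyr_bij _ _).1 h1

lemma gyr_zero (y z : G) : gyr 0 y z = z := by
  have h := lassoc 0 y z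
  rw [zadd, zadd] at h
  exact (lcancel h).symm

lemma neg_add_cancel_l (x y : G) : -x + (x + y) = y := by
  rw [lassoc, nadd, zadd]
  have h : gyr (-x + x) x = gyr (-x) x := Gyrogroup.loop (-x) x
  rw [← h, nadd, gyr_zero]

lemma add_neg_cancel_l (x y : G) : x + (-x + y) = y := by
  rw [lassoc, addn, zadd]
  have h : gyr (x + -x) (-x) = gyr x (-x) := Gyrogroup.loop x (-x)
  rw [← h, addn, gyr_zero]

lemma neg_add_trans (a x y : G) : -(a + x) + (a + y) = gyr a x (-x + y) := by
  have h : a + y = (a + x) + gyr a x (-x + y) := by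
    rw [← lassoc, add_neg_cancel_l]
  rw [h, neg_add_cancel_l]

end alg

/-- A left invariant continuous pseudometric. -/
structure LPM {G : Type u} [Gyrogroup G] [TopologicalSpace G] (D : G → G → ℝ) : Prop where
  self : ∀ x, D x x = 0
  nonneg : ∀ x y, 0 ≤ D x y
  symm : ∀ x y, D x y = D y x
  tri : ∀ x y z, D x z ≤ D x y + D y z
  linv : ∀ a x y, D (a + x) (a + y) = D x y
  cont0 : Continuous fun y => D 0 y

section top
variable {G : Type u} [Gyrogroup G] [TopologicalSpace G]

lemma LPM.cont [TopGyrogroup G] {D : G → G → ℝ} (h : LPM D) :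
    Continuous fun p : G × G => D p.1 p.2 := by
  have e : (fun p : G × G => D p.1 p.2) = fun p : G × G => D 0 (-p.1 + p.2) := by
    funext p
    rw [← h.linv (-p.1) p.1 p.2, nadd]
  rw [e]
  exact h.cont0.comp ((TopGyrogroup.continuous_add (G := G)).comp
    (((TopGyrogroup.continuous_neg (G := G)).comp continuous_fst).prodMk continuous_snd))

lemma LPM.cont_r [TopGyrogroup G] {D : G → G → ℝ} (h : LPM D) (x : G) :
    Continuous fun y => D x y := h.cont.comp (continuous_const.prodMk continuous_id)

lemma LPM.add_r {D : G → G → ℝ} (h : LPM D) (x w : G) : D x (x + w) = D 0 w := by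
  conv_lhs => rw [← addz x]
  rw [addz x, ← h.linv x 0 w, addz]

lemma LPM.zero_neg {D : G → G → ℝ} (h : LPM D) (x : G) : D 0 (-x) = D 0 x := by
  rw [← h.linv x 0 (-x), addz, addn, h.symm]

lemma LPM.neg_add_eq {D : G → G → ℝ} (h : LPM D) (x y : G) : D 0 (-x + y) = D x y := by
  rw [← h.linv (-x) x y, nadd]

lemma LPM.add_left_eq {D : G → G → ℝ} (h : LPM D) (m m' g : G) :
    D (m + m') g = D m' (-m + g) := by
  rw [← h.linv m m' (-m + g), add_neg_cancel_l]

lemma LPM.trans0 {D : G → G → ℝ} (h : LPM D) {x y z : G} (h1 : D x y = 0) (h2 : D y z = 0) :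
    D x z = 0 := le_antisymm (by linarith [h.tri x y z]) (h.nonneg _ _)

lemma LPM.congr_r {D : G → G → ℝ} (h : LPM D) {x y z : G} (h1 : D y z = 0) :
    D x y = D x z := by
  have := h.tri x y z
  have := h.tri x z y
  rw [h.symm z y] at this
  linarith

lemma exists_LPM [TopGyrogroup G] [CompactSpace G] (hst : StronglyTop G) (f : C(G, ℝ)) :
    ∃ D : G → G → ℝ, LPM D ∧ ∀ x y, |f x - f y| ≤ D x y := by
  obtain ⟨μ, hμ1, hμ2, hμ3⟩ := hst
  let Γ : Set (G → G) := {k | ∀ U ∈ μ, ∀ x y, -x + y ∈ U → -(k x) + k y ∈ U}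
  have hid : id ∈ Γ := fun U _ x y h => h
  have hL : ∀ k ∈ Γ, ∀ a : G, (fun x => k (a + x)) ∈ Γ := by
    intro k hk a U hU x y h
    apply hk U hU
    rw [neg_add_trans, ← hμ3 U hU a x]
    exact ⟨_, h, rfl⟩
  haveI : Nonempty Γ := ⟨⟨id, hid⟩⟩
  obtain ⟨B, hB⟩ : ∃ B : ℝ, ∀ x, |f x| ≤ B :=
    ⟨‖f‖, fun x => f.norm_coe_le_norm x⟩
  have hbd : ∀ x y, BddAbove (Set.range fun k : Γ => |f (k.1 x) - f (k.1 y)|) := by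
    intro x y
    refine ⟨B + B, ?_⟩
    rintro _ ⟨k, rfl⟩
    exact (abs_sub _ _).trans (add_le_add (hB _) (hB _))
  let D : G → G → ℝ := fun x y => ⨆ k : Γ, |f (k.1 x) - f (k.1 y)|
  have hle : ∀ (k : Γ) x y, |f (k.1 x) - f (k.1 y)| ≤ D x y := fun k x y =>
    le_ciSup (hbd x y) k
  have hnn : ∀ x y, 0 ≤ D x y := fun x y => (abs_nonneg _).trans (hle ⟨id, hid⟩ x y)
  have hsymm : ∀ x y, D x y = D y x := by
    intro x y
    simp only [D, abs_sub_comm]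
  have htri : ∀ x y z, D x z ≤ D x y + D y z := by
    intro x y z
    refine ciSup_le fun k => ?_
    exact (abs_sub_le _ (f (k.1 y)) _).trans (add_le_add (hle k x y) (hle k y z))
  have hinv1 : ∀ a x y, D (a + x) (a + y) ≤ D x y := by
    intro a x y
    refine ciSup_le fun k => ?_
    exact hle ⟨_, hL k.1 k.2 a⟩ x y
  have hinv : ∀ a x y, D (a + x) (a + y) = D x y := by
    intro a x y
    refine le_antisymm (hinv1 a x y) ?_
    have := hinv1 (-a) (a + x) (a + y)
    rwa [neg_add_cancel_l, neg_add_cancel_l] at this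
  have hadd := TopGyrogroup.continuous_add (G := G)
  refine ⟨D, ⟨?_, hnn, hsymm, htri, hinv, ?_⟩, fun x y => hle ⟨id, hid⟩ x y⟩
  · intro x
    simp [D]
  · -- uniform continuity
    have huc : ∀ ε > 0, ∃ U ∈ μ, ∀ x y, -x + y ∈ U → |f x - f y| < ε := by
      intro ε hε
      let W : Set (G × G) := {p | |f p.1 - f (p.1 + p.2)| < ε}
      have hW : IsOpen W := by
        refine isOpen_lt ?_ continuous_const
        exact ((f.continuous.comp continuous_fst).sub (f.continuous.comp hadd)).abs
      have hsub : (Set.univ : Set G) ×ˢ ({0} : Set G) ⊆ W := by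
        rintro ⟨x, u⟩ ⟨_, hu⟩
        have hu' : u = 0 := hu
        simp [W, hu', addz, hε]
      obtain ⟨u, v, hu, hv, huu, hvv, huv⟩ :=
        generalized_tube_lemma isCompact_univ isCompact_singleton hW hsub
      obtain ⟨U, hU, hUv⟩ := hμ2 v (hv.mem_nhds (hvv rfl))
      refine ⟨U, hU, fun x y h => ?_⟩
      have : (x, -x + y) ∈ W := huv ⟨huu trivial, hUv h⟩
      simpa [W, add_neg_cancel_l] using this
    rw [continuous_iff_continuousAt]
    intro y
    rw [Metric.continuousAt_iff']
    intro ε hε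
    obtain ⟨U, hU, hUf⟩ := huc (ε / 2) (half_pos hε)
    have hc : Tendsto (fun z : G => -y + z) (𝓝 y) (𝓝 0) := by
      have : Continuous fun z : G => -y + z :=
        hadd.comp (continuous_const.prodMk continuous_id)
      have h2 := this.tendsto y
      rwa [nadd] at h2
    filter_upwards [hc (hμ1 U hU)] with z hz
    have hz' : -y + z ∈ U := hz
    have h1 : D y z ≤ ε / 2 := ciSup_le fun k => (hUf _ _ (k.2 U hU y z hz')).le
    rw [Real.dist_eq, abs_lt]
    have h2 := htri 0 y z
    have h3 := htri 0 z y
    rw [hsymm z y] at h3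
    constructor <;> linarith

end top

/-- Nested compactness. -/
lemma nested {X I : Type*} [TopologicalSpace X] [CompactSpace X] [LinearOrder I]
    (J : Set I) (K : Set X) (hK : IsClosed K) (hKn : K.Nonempty) (B : I → Set X)
    (hB : ∀ i ∈ J, IsClosed (B i)) (hBK : ∀ i ∈ J, B i ⊆ K)
    (hn : ∀ i ∈ J, (B i).Nonempty) (hanti : ∀ i ∈ J, ∀ j ∈ J, i ≤ j → B j ⊆ B i) :
    ∃ y ∈ K, ∀ i ∈ J, y ∈ B i := by
  rcases J.eq_empty_or_nonempty with rfl | hJ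
  · obtain ⟨y, hy⟩ := hKn
    exact ⟨y, hy, by simp⟩
  haveI : Nonempty J := hJ.to_subtype
  have := IsCompact.nonempty_iInter_of_directed_nonempty_isCompact_isClosed
    (fun j : J => B j.1) (by
      intro i j
      rcases le_total i.1 j.1 with h | h
      · exact ⟨j, hanti _ i.2 _ j.2 h, subset_rfl⟩
      · exact ⟨i, subset_rfl, hanti _ j.2 _ i.2 h⟩)
    (fun j => hn _ j.2) (fun j => (hB _ j.2).isCompact) (fun j => hB _ j.2)
  obtain ⟨y, hy⟩ := this
  rw [Set.mem_iInter] at hy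
  obtain ⟨j0⟩ := ‹Nonempty J›
  exact ⟨y, hBK _ j0.2 (hy j0), fun i hi => hy ⟨i, hi⟩⟩

lemma lexmin {X I : Type*} [TopologicalSpace X] [CompactSpace X] [LinearOrder I]
    [WellFoundedLT I] (K : Set X) (hK : IsClosed K) (hKn : K.Nonempty) (φ : I → X → ℝ)
    (hφ : ∀ i, Continuous (φ i)) :
    ∃ y ∈ K, ∀ i, ∀ z ∈ K, (∀ j < i, φ j z = φ j y) → φ i y ≤ φ i z := by
  let m : I → ℝ := (wellFounded_lt (α := I)).fix fun i rec =>
    sInf (φ i '' {z | z ∈ K ∧ ∀ j (h : j < i), φ j z = rec j h})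
  have hm : ∀ i, m i = sInf (φ i '' {z | z ∈ K ∧ ∀ j < i, φ j z = m j}) := by
    intro i
    exact WellFounded.fix_eq _ _ i
  let A : I → Set X := fun i => {z | z ∈ K ∧ ∀ j < i, φ j z = m j}
  let B : I → Set X := fun i => {z | z ∈ K ∧ ∀ j ≤ i, φ j z = m j}
  have hBc : ∀ i, IsClosed (B i) := by
    intro i
    have : B i = K ∩ ⋂ j, ⋂ (_ : j ≤ i), {z | φ j z = m j} := by
      ext z; simp [B]
    rw [this]
    exact hK.inter (isClosed_iInter fun j => isClosed_iInter fun _ =>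
      isClosed_eq (hφ j) continuous_const)
  have hAc : ∀ i, IsClosed (A i) := by
    intro i
    have : A i = K ∩ ⋂ j, ⋂ (_ : j < i), {z | φ j z = m j} := by
      ext z; simp [A]
    rw [this]
    exact hK.inter (isClosed_iInter fun j => isClosed_iInter fun _ =>
      isClosed_eq (hφ j) continuous_const)
  have hanti : ∀ i j, i ≤ j → B j ⊆ B i := fun i j h z hz =>
    ⟨hz.1, fun k hk => hz.2 k (hk.trans h)⟩
  have hBn : ∀ i, (B i).Nonempty := by
    intro i
    induction i using WellFoundedLT.induction with
    | ind i ih =>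
      obtain ⟨y, hyK, hy⟩ := nested (Set.Iio i) K hK hKn B (fun i _ => hBc i)
        (fun i _ z hz => hz.1) (fun j hj => ih j hj) (fun i _ j _ h => hanti i j h)
      have hAn : (A i).Nonempty := ⟨y, hyK, fun j hj => (hy j hj).2 j le_rfl⟩
      obtain ⟨z, hz, hzm⟩ := (hAc i).isCompact.exists_sInf_image_eq hAn (hφ i).continuousOn
      refine ⟨z, hz.1, fun j hj => ?_⟩
      rcases hj.lt_or_eq with h | rfl
      · exact hz.2 j h
      · rw [hm]; exact hzm.symm
  obtain ⟨y, hyK, hy⟩ := nested Set.univ K hK hKn B (fun i _ => hBc i)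
        (fun i _ z hz => hz.1) (fun j _ => hBn j) (fun i _ j _ h => hanti i j h)
  have hy' : ∀ i, φ i y = m i := fun i => (hy i trivial).2 i le_rfl
  refine ⟨y, hyK, fun i z hz h => ?_⟩
  rw [hy', hm]
  refine csInf_le ?_ ⟨z, ⟨hz, fun j hj => (h j hj).trans (hy' j)⟩, rfl⟩
  exact ((hAc i).isCompact.image (hφ i)).bddBelow

lemma suitable_of_tendsto {G : Type u} [Gyrogroup G] [TopologicalSpace G] [T2Space G]
    {X : Type*} (y : X → G) (hy : Tendsto y cofinite (𝓝 0)) :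
    DiscreteTopology ↥(Set.range y \ {0}) ∧ IsClosed ((Set.range y \ {0}) ∪ {(0 : G)}) := by
  have key : ∀ p : G, p ≠ 0 → ∃ V ∈ 𝓝 p, (V ∩ Set.range y).Finite ∧ (0 : G) ∉ V := by
    intro p hp
    obtain ⟨V, W, hV, hW, hpV, h0W, hd⟩ := t2_separation hp
    have hfin : {x | y x ∉ W}.Finite := hy (hW.mem_nhds h0W)
    refine ⟨V, hV.mem_nhds hpV, (hfin.image y).subset ?_, fun h => hd.le_bot ⟨h, h0W⟩⟩
    rintro _ ⟨hv, x, rfl⟩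
    exact ⟨x, fun h => hd.le_bot ⟨hv, h⟩, rfl⟩
  constructor
  · rw [discreteTopology_subtype_iff']
    rintro p ⟨hpr, hp0⟩
    obtain ⟨V, hV, hfin, h0⟩ := key p hp0
    have hfin2 : ((V ∩ Set.range y) \ {p}).Finite := hfin.subset Set.diff_subset
    refine ⟨interior V ∩ ((V ∩ Set.range y) \ {p})ᶜ, isOpen_interior.inter
      hfin2.isClosed.isOpen_compl, ?_⟩
    ext q
    constructor
    · rintro ⟨⟨h1, h2⟩, h3, h4⟩
      by_contra hq
      exact h2 ⟨⟨interior_subset h1, h3⟩, hq⟩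
    · rintro rfl
      exact ⟨⟨mem_interior_iff_mem_nhds.2 hV, fun h => h.2 rfl⟩, hpr, hp0⟩
  · rw [← isOpen_compl_iff, isOpen_iff_mem_nhds]
    intro p hp
    have hp0 : p ≠ 0 := fun h => hp (Or.inr h)
    have hpr : p ∉ Set.range y := fun h => hp (Or.inl ⟨h, hp0⟩)
    obtain ⟨V, hV, hfin, h0⟩ := key p hp0
    filter_upwards [hV, hfin.isClosed.isOpen_compl.mem_nhds (fun h => hpr h.2)] with q h1 h2
    rintro (h | h)
    · exact h2 ⟨h1, h.1⟩
    · have hq : q = 0 := h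
      exact h0 (hq ▸ h1)

lemma main_aux {G : Type u} [Gyrogroup G] [TopologicalSpace G]
    [TopGyrogroup G] [CompactSpace G] {I : Type*} [LinearOrder I] [WellFoundedLT I]
    (D : I → G → G → ℝ) (hD : ∀ i, LPM (D i))
    (hsep : ∀ x y, (∀ i, D i x y = 0) → x = y) :
    ∃ S : Set G, IsSuitable S := by
  haveI : T2Space G := TopGyrogroup.t2
  have hadd := TopGyrogroup.continuous_add (G := G)
  let r : ℕ → ℝ := fun n => (1 / 2 : ℝ) ^ n
  have hr : ∀ n, 0 < r n := fun n => by positivity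
  have hr0 : Tendsto r atTop (𝓝 0) :=
    tendsto_pow_atTop_nhds_zero_of_lt_one (by norm_num) (by norm_num)
  let K : I → ℕ → Set G := fun α n =>
    {u | (∀ γ < α, D γ 0 u = 0) ∧ (0 < n → D α 0 u ≤ 2 * r n)}
  have hKc : ∀ α n, IsClosed (K α n) := by
    intro α n
    have : K α n = (⋂ γ, ⋂ (_ : γ < α), {u | D γ 0 u = 0}) ∩
        ⋂ (_ : 0 < n), {u | D α 0 u ≤ 2 * r n} := by
      ext z; simp [K]
    rw [this]
    exact (isClosed_iInter fun j => isClosed_iInter fun _ =>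
      isClosed_eq (hD j).cont0 continuous_const).inter
      (isClosed_iInter fun _ => isClosed_le (hD α).cont0 continuous_const)
  have hF : ∀ α n, ∃ F : Finset G, (∀ x ∈ F, x ∈ K α n) ∧
      ∀ u ∈ K α n, ∃ s ∈ F, D α s u < r n := by
    intro α n
    obtain ⟨t, ht, htc⟩ := (hKc α n).isCompact.elim_nhds_subcover
      (fun s => {u | D α s u < r n}) (fun s _ => by
        refine (isOpen_lt ((hD α).cont_r s) continuous_const).mem_nhds ?_
        simp only [Set.mem_setOf_eq, (hD α).self]
        exact hr n)
    refine ⟨t, ht, fun u hu => ?_⟩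
    simpa using htc hu
  choose F hFK hFn using hF
  have hlift : ∀ (α : I) (s : G), ∃ y, (∀ γ ≤ α, D γ s y = 0) ∧
      ∀ γ, α < γ → ∀ y0, (∀ j < γ, D j 0 y0 = 0) → D γ 0 y ≤ D γ 0 (y + -y0) := by
    intro α s
    obtain ⟨y, hy, hmin⟩ := lexmin (I := I) {y | ∀ γ ≤ α, D γ s y = 0} (by
        simp only [Set.setOf_forall]
        exact isClosed_iInter fun j => isClosed_iInter fun _ =>
          isClosed_eq ((hD j).cont_r s) continuous_const) ⟨s, fun γ _ => (hD γ).self s⟩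
      (fun i y => D i 0 y) (fun i => (hD i).cont0)
    refine ⟨y, hy, fun γ hγ y0 hy0 => ?_⟩
    have h0 : ∀ j < γ, D j y (y + -y0) = 0 := fun j hj => by
      rw [(hD j).add_r, (hD j).zero_neg, hy0 j hj]
    refine hmin γ _ (fun j hj => (hD j).trans0 (hy j hj) (h0 j (hj.trans_lt hγ))) ?_
    intro j hj
    exact ((hD j).congr_r (h0 j hj)).symm
  choose Y hY1 hY2 using hlift
  let X := Σ α : I, Σ n : ℕ, {s // s ∈ F α n}
  let y : X → G := fun x => Y x.1 x.2.2.1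
  have hyK : ∀ x : X, y x ∈ K x.1 x.2.1 := by
    rintro ⟨α, n, s, hs⟩
    have h1 := hFK α n s hs
    refine ⟨fun γ hγ => ?_, fun hn => ?_⟩
    · exact (hD γ).trans0 (h1.1 γ hγ) (hY1 α s γ hγ.le)
    · have := (hD α).congr_r (x := 0) (hY1 α s α le_rfl)
      exact this ▸ h1.2 hn
  have hlim : Tendsto y cofinite (𝓝 0) := by
    rw [tendsto_iff_ultrafilter]
    intro 𝓕 h𝓕
    obtain ⟨y0, -, hy0⟩ := isCompact_univ.ultrafilter_le_nhds (𝓕.map y) (by simp)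
    have hy0 : Tendsto y 𝓕 (𝓝 y0) := hy0
    suffices h : ∀ γ, D γ 0 y0 = 0 by
      rwa [← hsep 0 y0 h] at hy0
    intro γ
    induction γ using WellFoundedLT.induction with
    | ind γ ih =>
    have ht : Tendsto (fun x => D γ 0 (y x)) 𝓕 (𝓝 (D γ 0 y0)) :=
      ((hD γ).cont0.tendsto y0).comp hy0
    have htri : (∀ᶠ x : X in (𝓕 : Filter X), x.1 < γ) ∨ (∀ᶠ x : X in (𝓕 : Filter X), x.1 = γ) ∨
        (∀ᶠ x : X in (𝓕 : Filter X), γ < x.1) := by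
      rw [← Ultrafilter.eventually_or, ← Ultrafilter.eventually_or]
      exact Eventually.of_forall fun x => lt_trichotomy x.1 γ
    refine le_antisymm ?_ ((hD γ).nonneg _ _)
    rcases htri with h | h | h
    · have h2 : Tendsto (fun x => D γ 0 (y x + -y0)) 𝓕 (𝓝 (D γ 0 (y0 + -y0))) := by
        have hc : Continuous fun z : G => D γ 0 (z + -y0) :=
          (hD γ).cont0.comp (hadd.comp (continuous_id.prodMk continuous_const))
        exact (hc.tendsto y0).comp hy0
      rw [addn, (hD γ).self] at h2
      refine le_of_tendsto_of_tendsto ht h2 ?_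
      filter_upwards [h] with x hx
      exact hY2 _ _ γ hx y0 ih
    · have hN : ∀ n, D γ 0 y0 ≤ 2 * r n := by
        intro n
        refine le_of_tendsto ht ?_
        have hfin : {x : X | x.1 = γ ∧ x.2.1 ≤ n}.Finite := by
          let T := Σ k : Fin (n + 1), {s // s ∈ F γ k}
          refine (Set.finite_range (fun t : T => (⟨γ, t.1, t.2⟩ : X))).subset ?_
          rintro ⟨α, k, s⟩ ⟨h1, h2⟩
          dsimp only at h1 h2
          subst h1
          exact ⟨⟨⟨k, Nat.lt_succ_of_le h2⟩, s⟩, rfl⟩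
        have hc : ∀ᶠ x : X in (𝓕 : Filter X), ¬ (x.1 = γ ∧ x.2.1 ≤ n) :=
          h𝓕 hfin.compl_mem_cofinite
        filter_upwards [h, hc] with x hx hx2
        have hlt : n < x.2.1 := by
          by_contra hh
          exact hx2 ⟨hx, not_lt.1 hh⟩
        have h3 := (hyK x).2 (by omega)
        have h6 : D γ 0 (y x) = D x.1 0 (y x) := congrArg (fun i => D i 0 (y x)) hx.symm
        rw [h6]
        have h4 : r x.2.1 ≤ r n :=
          pow_le_pow_of_le_one (by norm_num) (by norm_num) hlt.le
        linarith
      have h5 : Tendsto (fun n => 2 * r n) atTop (𝓝 0) := by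
        simpa using hr0.const_mul 2
      exact ge_of_tendsto h5 (Eventually.of_forall hN)
    · refine le_of_tendsto ht ?_
      filter_upwards [h] with x hx
      exact ((hyK x).1 γ hx).le
  obtain ⟨hd, hc⟩ := suitable_of_tendsto y hlim
  refine ⟨_, hd, hc, ?_⟩
  set S := Set.range y \ {(0 : G)} with hS
  let M := closure (gen S)
  have hgen0 : (0 : G) ∈ gen S := fun T hT => hT.1.1
  have hgenadd : ∀ a ∈ gen S, ∀ b ∈ gen S, a + b ∈ gen S := fun a ha b hb T hT =>
    hT.1.2.1 (ha T hT) (hb T hT)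
  have hM0 : (0 : G) ∈ M := subset_closure hgen0
  have hMadd : ∀ a ∈ M, ∀ b ∈ M, a + b ∈ M := fun a ha b hb =>
    map_mem_closure₂ (f := fun a b : G => a + b) hadd ha hb hgenadd
  have hMc : IsClosed M := isClosed_closure
  have hyM : ∀ x, y x ∈ M := by
    intro x
    by_cases h : y x = 0
    · rw [h]; exact hM0
    · exact subset_closure fun T hT => hT.2 ⟨⟨x, rfl⟩, h⟩
  -- approximation inside `N_α`
  have happ : ∀ (α : I) (g : G), (∀ γ < α, D γ 0 g = 0) → ∀ n : ℕ,
      ∃ m ∈ M, (∀ γ < α, D γ 0 m = 0) ∧ D α m g ≤ r n := by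
    intro α g hg n
    have step : ∀ n (m : G), m ∈ M → (∀ γ < α, D γ 0 m = 0) →
        (0 < n → D α m g ≤ 2 * r n) →
        ∃ m ∈ M, (∀ γ < α, D γ 0 m = 0) ∧ D α m g ≤ r n := by
      intro n m hm hm0 hmn
      have hu : -m + g ∈ K α n := by
        refine ⟨fun γ hγ => ?_, fun hn => ?_⟩
        · rw [(hD γ).neg_add_eq]
          exact (hD γ).trans0 (((hD γ).symm _ _).trans (hm0 γ hγ)) (hg γ hγ)
        · rw [(hD α).neg_add_eq]; exact hmn hn
      obtain ⟨s, hs, hsu⟩ := hFn α n _ hu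
      let x : X := ⟨α, n, s, hs⟩
      refine ⟨m + y x, hMadd _ hm _ (hyM x), fun γ hγ => ?_, ?_⟩
      · refine (hD γ).trans0 (hm0 γ hγ) ?_
        rw [(hD γ).add_r]
        exact (hyK x).1 γ hγ
      · rw [(hD α).add_left_eq]
        have h1 : D α s (y x) = 0 := hY1 α s α le_rfl
        have h2 := (hD α).tri (y x) s (-m + g)
        rw [(hD α).symm (y x) s, h1] at h2
        linarith
    induction n with
    | zero => exact step 0 0 hM0 (fun γ _ => (hD γ).self 0) (fun h => absurd h (lt_irrefl _))
    | succ n ih =>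
      obtain ⟨m, hm, hm0, hmn⟩ := ih
      refine step (n + 1) m hm hm0 fun _ => ?_
      have : 2 * r (n + 1) = r n := by simp only [r, pow_succ]; ring
      rwa [this]
  have hcl : ∀ (g : G) (P : I → Prop), IsClosed {m | m ∈ M ∧ ∀ γ, P γ → D γ g m = 0} := by
    intro g P
    have : {m | m ∈ M ∧ ∀ γ, P γ → D γ g m = 0} =
        M ∩ ⋂ γ, ⋂ (_ : P γ), {m | D γ g m = 0} := by
      ext z; simp
    rw [this]
    exact hMc.inter (isClosed_iInter fun j => isClosed_iInter fun _ =>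
      isClosed_eq ((hD j).cont_r g) continuous_const)
  have hdense : ∀ g : G, g ∈ M := by
    intro g
    have hind : ∀ α, {m | m ∈ M ∧ ∀ γ, γ ≤ α → D γ g m = 0}.Nonempty := by
      intro α
      induction α using WellFoundedLT.induction with
      | ind α ih =>
      obtain ⟨m, hm, hmα⟩ := nested (Set.Iio α) M hMc ⟨0, hM0⟩
        (fun α => {m | m ∈ M ∧ ∀ γ, γ ≤ α → D γ g m = 0}) (fun i _ => hcl g _)
        (fun i _ z hz => hz.1) (fun i hi => ih i hi)
        (fun i _ j _ hij z hz => ⟨hz.1, fun γ h => hz.2 γ (h.trans hij)⟩)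
      have hmg : ∀ γ < α, D γ g m = 0 := fun γ hγ => (hmα γ hγ).2 γ le_rfl
      let A := {m | m ∈ M ∧ ∀ γ, γ < α → D γ g m = 0}
      have hAc : IsClosed A := hcl g _
      obtain ⟨z, hz, hzmin⟩ := hAc.isCompact.exists_isMinOn ⟨m, hm, hmg⟩
        ((hD α).cont_r g).continuousOn
      refine ⟨z, hz.1, fun γ hγ => ?_⟩
      rcases hγ.lt_or_eq with h | rfl
      · exact hz.2 γ h
      refine le_antisymm ?_ ((hD γ).nonneg _ _)
      refine ge_of_tendsto hr0 (Eventually.of_forall fun n => ?_)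
      obtain ⟨m', hm', hm0, hmn⟩ := happ γ (-m + g) (fun j hj => by
        rw [(hD j).neg_add_eq, (hD j).symm]; exact hmg j hj) n
      have hA : m + m' ∈ A := by
        refine ⟨hMadd _ hm _ hm', fun j hj => (hD j).trans0 (hmg j hj) ?_⟩
        rw [(hD j).add_r]; exact hm0 j hj
      have h1 : D γ g z ≤ D γ g (m + m') := hzmin hA
      rw [(hD γ).symm g (m + m'), (hD γ).add_left_eq] at h1
      exact h1.trans hmn
    obtain ⟨m, hm, hmα⟩ := nested Set.univ M hMc ⟨0, hM0⟩
        (fun α => {m | m ∈ M ∧ ∀ γ, γ ≤ α → D γ g m = 0}) (fun i _ => hcl g _)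
        (fun i _ z hz => hz.1) (fun i _ => hind i)
        (fun i _ j _ hij z hz => ⟨hz.1, fun γ h => hz.2 γ (h.trans hij)⟩)
    rw [hsep g m fun i => (hmα i trivial).2 i le_rfl]
    exact hm
  exact hdense

end Gyrogroup

open Gyrogroup
theorem compact_strongly_suitable {G : Type u} [Gyrogroup G] [TopologicalSpace G]
    [TopGyrogroup G] [CompactSpace G] (hst : StronglyTop G) :
    ∃ S : Set G, IsSuitable S := by
  haveI : T2Space G := TopGyrogroup.t2
  choose D hD hDf using fun f : C(G, ℝ) => exists_LPM hst f
  obtain ⟨_, _⟩ := exists_wellOrder C(G, ℝ)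
  refine main_aux D hD fun x y h => ?_
  by_contra hne
  obtain ⟨f, hf0, hf1, -⟩ := exists_continuous_zero_one_of_isClosed
    (isClosed_singleton (x := x)) (isClosed_singleton (x := y)) (by simpa using hne)
  have h1 := hDf f x y
  rw [h f, hf0 rfl, hf1 rfl] at h1
  norm_num at h1
end
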